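/- arXiv:1209.1249 — 4 statements merged into one kernel-verified Lean document; each statement's English description precedes it below -/
import Mathlib

section
/- Let n ≥ 1, let m ≤ n − 1, and let f : S^n → ℝ^m be a continuous map. Then some fiber of f has geodesic diameter at least π/2: there exist x, y ∈ S^n with f(x) = f(y) and ⟪x,y⟫ ≤ 0 (equivalently, geodesic distance arccos⟪x,y⟫ ≥ π/2). -/
open scoped RealInnerProductSpace
open MeasureTheory Topology Filter

lemma det_poly {E : Type*} [NormedAddCommGroup E] [NormedSpace ℝ E] [FiniteDimensional ℝ E]
    (A : E →L[ℝ] E) : ∃ p : Polynomial ℝ, p.natDegree ≤ Module.finrank ℝ E ∧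
      ∀ t : ℝ, p.eval t = (ContinuousLinearMap.id ℝ E + t • A).det := by
  classical
  let b := Module.finBasis ℝ E
  let M := LinearMap.toMatrix b b (A : E →ₗ[ℝ] E)
  refine ⟨Matrix.det ((Polynomial.X : Polynomial ℝ) • M.map Polynomial.C
    + (1 : Matrix _ _ ℝ).map Polynomial.C), ?_, ?_⟩
  · simpa using Polynomial.natDegree_det_X_add_C_le M 1
  · intro t
    rw [← Polynomial.coe_evalRingHom, RingHom.map_det]
    have : (ContinuousLinearMap.id ℝ E + t • A).det
        = LinearMap.det ((LinearMap.id : E →ₗ[ℝ] E) + t • (A : E →ₗ[ℝ] E)) := rfl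
    rw [this, ← LinearMap.det_toMatrix b]
    congr 1
    ext i j
    simp [M, Matrix.one_apply, LinearMap.toMatrix_apply, Finsupp.single_apply, add_comm, eq_comm]
    split_ifs <;> simp [mul_comm]

lemma poly_integral {E : Type*} [NormedAddCommGroup E] [NormedSpace ℝ E] [FiniteDimensional ℝ E]
    [MeasurableSpace E] (μ : Measure E) (A : E → E →L[ℝ] E)
    (hA : ∀ t : ℝ, Integrable (fun x => (ContinuousLinearMap.id ℝ E + t • A x).det) μ) :
    ∃ p : Polynomial ℝ,
      ∀ t : ℝ, p.eval t = ∫ x, (ContinuousLinearMap.id ℝ E + t • A x).det ∂μ := by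
  classical
  let s := Finset.range (Module.finrank ℝ E + 1)
  let v : ℕ → ℝ := fun i => i
  have hv : Set.InjOn v s := fun a _ b _ h => by simpa [v] using h
  refine ⟨Lagrange.interpolate s v
    (fun i => ∫ x, (ContinuousLinearMap.id ℝ E + v i • A x).det ∂μ), fun t => ?_⟩
  have key : ∀ x, (ContinuousLinearMap.id ℝ E + t • A x).det =
      ∑ i ∈ s, (ContinuousLinearMap.id ℝ E + v i • A x).det * (Lagrange.basis s v i).eval t := by
    intro x
    obtain ⟨p, hp, hpe⟩ := det_poly (A x)
    have h := Lagrange.eq_interpolate (f := p) hv (by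
      refine (Polynomial.degree_le_natDegree).trans_lt ?_
      simp only [s, Finset.card_range]
      exact_mod_cast Nat.lt_succ_of_le hp)
    rw [← hpe t, h, Lagrange.interpolate_apply]
    simp [Polynomial.eval_finsetSum, hpe]
  simp_rw [key]
  rw [integral_finsetSum _ (fun i _ => (hA (v i)).mul_const _)]
  simp [Lagrange.interpolate_apply, Polynomial.eval_finsetSum, integral_mul_const]

lemma det_zero {E : Type*} [NormedAddCommGroup E] [InnerProductSpace ℝ E] [FiniteDimensional ℝ E]
    (r : E → E) (x : E) (hd : DifferentiableAt ℝ r x) (hr : ∀ᶠ y in 𝓝 x, ‖r y‖ = 1) :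
    (fderiv ℝ r x).det = 0 := by
  by_contra hne
  have h1 : HasFDerivAt (fun y => ⟪r y, r y⟫) (0 : E →L[ℝ] ℝ) x := by
    refine (hasFDerivAt_const (1 : ℝ) x).congr_of_eventuallyEq ?_
    filter_upwards [hr] with y hy
    simp [hy]
  have h2 := hd.hasFDerivAt.inner ℝ hd.hasFDerivAt
  have h3 := h1.unique h2
  have h4 : ∀ v, ⟪r x, fderiv ℝ r x v⟫ = 0 := by
    intro v
    have := congrArg (fun L => L v) h3
    simp [real_inner_comm] at this
    have h5 := real_inner_comm (r x) (fderiv ℝ r x v)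
    linarith
  have hs : Function.Surjective (fderiv ℝ r x) := by
    have := LinearMap.isUnit_iff_isUnit_det (fderiv ℝ r x : E →ₗ[ℝ] E)
    have h6 := this.2 (isUnit_iff_ne_zero.2 hne)
    exact ((Module.End.isUnit_iff _).1 h6).2
  obtain ⟨v, hv⟩ := hs (r x)
  have := h4 v
  rw [hv, inner_self_eq_zero] at this
  have h7 := hr.self_of_nhds
  simp [this] at h7

lemma bij_ball {E : Type*} [NormedAddCommGroup E] [NormedSpace ℝ E] [CompleteSpace E]
    (h : E → E) (K : NNReal) (hK : LipschitzWith K h) (hz : ∀ x, 1 ≤ ‖x‖ → h x = 0)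
    (t : ℝ) (ht : 0 ≤ t) (htK : t * K < 1) :
    Function.Injective (fun x => x + t • h x) ∧
    (fun x => x + t • h x) '' Metric.ball 0 1 = Metric.ball 0 1 := by
  have hl : ∀ x y, ‖t • h x - t • h y‖ ≤ t * K * ‖x - y‖ := by
    intro x y
    rw [← smul_sub, norm_smul, Real.norm_of_nonneg ht, mul_assoc]
    gcongr
    simpa [dist_eq_norm] using hK.dist_le_mul x y
  have hinj : Function.Injective (fun x => x + t • h x) := by
    intro x y hxy
    simp only at hxy
    have h1 : x - y = t • h y - t • h x := by
      rw [sub_eq_sub_iff_add_eq_add, hxy, add_comm]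
    have h2 := hl y x
    rw [← h1, norm_sub_rev y x] at h2
    have : ‖x - y‖ = 0 := by nlinarith [norm_nonneg (x - y)]
    exact sub_eq_zero.1 (norm_eq_zero.1 this)
  have hsurj : Function.Surjective (fun x => x + t • h x) := by
    intro y
    have hc : ContractingWith (⟨t * K, by positivity⟩ : NNReal) (fun x => y - t • h x) := by
      refine ⟨by exact_mod_cast htK, LipschitzWith.of_dist_le_mul fun a b => ?_⟩
      rw [dist_eq_norm, dist_eq_norm, sub_sub_sub_cancel_left, norm_sub_rev a b]
      exact hl b a
    refine ⟨hc.fixedPoint, ?_⟩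
    have := hc.fixedPoint_isFixedPt
    have h2 : y - t • h hc.fixedPoint = hc.fixedPoint := this
    simp only
    nth_rewrite 1 [← h2]
    abel
  refine ⟨hinj, ?_⟩
  have hfix : ∀ x, 1 ≤ ‖x‖ → x + t • h x = x := fun x hx => by simp [hz x hx]
  ext y
  constructor
  · rintro ⟨x, hx, rfl⟩
    by_contra hy
    simp only [Metric.mem_ball, dist_zero_right, not_lt] at hy hx
    have := hinj (hfix _ hy)
    simp only at this
    rw [this] at hy
    linarith
  · intro hy
    obtain ⟨x, rfl⟩ := hsurj y
    refine ⟨x, ?_, rfl⟩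
    by_contra hx
    simp only [Metric.mem_ball, dist_zero_right, not_lt] at hy hx
    rw [hfix x hx] at hy
    linarith

lemma lip_ext {E : Type*} [NormedAddCommGroup E] [NormedSpace ℝ E]
    (h : E → E) (K : NNReal) (hK : LipschitzOnWith K h (Metric.closedBall 0 1))
    (hz : ∀ x, ‖x‖ = 1 → h x = 0) :
    LipschitzWith K ((Metric.closedBall (0:E) 1).indicator h) := by
  classical
  have mix : ∀ x y : E, ‖x‖ ≤ 1 → 1 < ‖y‖ → ‖h x‖ ≤ K * dist x y := by
    intro x y hx hy
    have hc : ContinuousOn (fun s : ℝ => ‖AffineMap.lineMap x y s‖) (Set.Icc 0 1) := by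
      apply Continuous.continuousOn
      exact (AffineMap.lineMap_continuous).norm
    obtain ⟨s, hs, hs1⟩ := intermediate_value_Icc (zero_le_one) hc
      (show (1:ℝ) ∈ _ by simp [hx, hy.le])
    simp only at hs1
    set z := (AffineMap.lineMap x y s : E)
    have h1 := hK.dist_le_mul x (by simpa using hx) z (by simp [hs1])
    rw [hz z hs1, dist_zero_right] at h1
    refine h1.trans ?_
    gcongr
    rw [dist_left_lineMap]
    rw [Real.norm_of_nonneg hs.1]
    exact mul_le_of_le_one_left dist_nonneg hs.2
  refine LipschitzWith.of_dist_le_mul fun x y => ?_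
  by_cases hx : ‖x‖ ≤ 1 <;> by_cases hy : ‖y‖ ≤ 1
  · simpa [Set.indicator, hx, hy] using hK.dist_le_mul x (by simpa using hx) y (by simpa using hy)
  · simpa [Set.indicator, hx, hy] using mix x y hx (not_le.1 hy)
  · rw [dist_comm x y]
    simpa [Set.indicator, hx, hy] using mix y x hy (not_le.1 hx)
  · simp [Set.indicator, hx, hy]; positivity

lemma no_retraction {E : Type*} [NormedAddCommGroup E] [InnerProductSpace ℝ E]
    [FiniteDimensional ℝ E] [MeasurableSpace E] [BorelSpace E]
    (r : E → E) (hr : ∀ x, ‖x‖ ≤ 1 → ContDiffAt ℝ 1 r x)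
    (h1 : ∀ x, ‖x‖ ≤ 1 → ‖r x‖ = 1) (h2 : ∀ x, ‖x‖ = 1 → r x = x) : False := by
  let μ : Measure E := Measure.addHaar
  let h : E → E := fun x => r x - x
  have hcd : ∀ x, ‖x‖ ≤ 1 → ContDiffAt ℝ 1 h x := fun x hx => (hr x hx).sub contDiffAt_id
  have hdiff : ∀ x, ‖x‖ ≤ 1 → DifferentiableAt ℝ h x := fun x hx =>
    (hcd x hx).differentiableAt one_ne_zero
  have hcomp : IsCompact (Metric.closedBall (0:E) 1) := isCompact_closedBall 0 1
  have hcont : ∀ x, ‖x‖ ≤ 1 → ContinuousAt (fderiv ℝ h) x := fun x hx =>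
    ((hcd x hx).fderiv_right (m := 0) (by norm_num)).continuousAt
  obtain ⟨K, hK⟩ : ∃ K, LipschitzOnWith K h (Metric.closedBall 0 1) :=
    ContDiffOn.exists_lipschitzOnWith (n := 1)
      (fun x hx => (hcd x (by simpa using hx)).contDiffWithinAt) one_ne_zero
      (convex_closedBall 0 1) hcomp
  have hz : ∀ x, ‖x‖ = 1 → h x = 0 := fun x hx => by simp [h, h2 x hx]
  have hK' := lip_ext h K hK hz
  set g := (Metric.closedBall (0:E) 1).indicator h with hg
  have hgz : ∀ x, 1 ≤ ‖x‖ → g x = 0 := by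
    intro x hx
    rcases hx.eq_or_lt with hx | hx
    · simp [hg, Set.indicator, hz x hx.symm]
    · simp [hg, not_le.2 hx]
  have hgd : ∀ x, ‖x‖ < 1 → HasFDerivAt g (fderiv ℝ h x) x := by
    intro x hx
    refine (hdiff x hx.le).hasFDerivAt.congr_of_eventuallyEq ?_
    filter_upwards [Metric.isOpen_ball.mem_nhds (show x ∈ Metric.ball (0:E) 1 by simpa using hx)]
      with y hy
    exact Set.indicator_of_mem (Metric.ball_subset_closedBall hy) _
  let D : ℝ → E → ℝ := fun t x => (ContinuousLinearMap.id ℝ E + t • fderiv ℝ h x).det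
  have hDc : ∀ t x, ‖x‖ ≤ 1 → ContinuousAt (fun z : ℝ × E => D z.1 z.2) (t, x) := by
    intro t x hx
    refine ContinuousLinearMap.continuous_det.continuousAt.comp ?_
    refine continuousAt_const.add (continuousAt_fst.smul ?_)
    exact ContinuousAt.comp (f := Prod.snd) (hcont x hx) continuousAt_snd
  have hint : ∀ t, Integrable (D t) (μ.restrict (Metric.ball 0 1)) := by
    intro t
    have : IntegrableOn (D t) (Metric.closedBall 0 1) μ := by
      refine ContinuousOn.integrableOn_compact hcomp ?_
      intro x hx
      refine ContinuousAt.continuousWithinAt ?_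
      exact ContinuousAt.comp (f := fun y => (t, y)) (hDc t x (by simpa using hx)) (by fun_prop)
    exact this.mono_set Metric.ball_subset_closedBall
  obtain ⟨p, hp⟩ := poly_integral (μ.restrict (Metric.ball 0 1)) (fderiv ℝ h) hint
  have hpos : ∀ᶠ t in 𝓝 (0:ℝ), ∀ x ∈ Metric.closedBall (0:E) 1, 0 < D t x := by
    refine hcomp.eventually_forall_of_forall_eventually fun x hx => ?_
    refine (hDc 0 x (by simpa using hx)).eventually (lt_mem_nhds ?_)
    have : (ContinuousLinearMap.id ℝ E).det = 1 := LinearMap.det_id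
    simp [D, this]
  have hKs : ∀ᶠ t in 𝓝 (0:ℝ), t * (K:ℝ) < 1 := by
    have : Continuous fun t : ℝ => t * (K:ℝ) := by fun_prop
    exact (this.continuousAt (x := 0)).eventually (gt_mem_nhds (by simp))
  have hev : ∀ᶠ t in 𝓝[>] (0:ℝ), p.eval t = μ.real (Metric.ball 0 1) := by
    filter_upwards [hpos.filter_mono nhdsWithin_le_nhds, hKs.filter_mono nhdsWithin_le_nhds,
      self_mem_nhdsWithin] with t ht1 ht2 ht3
    have ht3 : 0 < t := ht3
    obtain ⟨hinj, him⟩ := bij_ball g K hK' hgz t ht3.le ht2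
    have hcv := integral_image_eq_integral_abs_det_fderiv_smul μ
      (measurableSet_ball (x := (0:E)) (ε := 1))
      (f := fun x => x + t • g x)
      (f' := fun x => ContinuousLinearMap.id ℝ E + t • fderiv ℝ h x)
      (fun x hx => ((hasFDerivAt_id x).add
        ((hgd x (by simpa using hx)).const_smul t)).hasFDerivWithinAt)
      hinj.injOn (fun _ => (1:ℝ))
    rw [him] at hcv
    rw [hp t]
    simp only [integral_const, smul_eq_mul, mul_one, measureReal_restrict_apply_univ] at hcv
    rw [hcv]
    refine setIntegral_congr_fun measurableSet_ball fun x hx => ?_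
    exact (abs_of_pos (ht1 x (Metric.ball_subset_closedBall hx))).symm
  have hpc : p = Polynomial.C (μ.real (Metric.ball 0 1)) := by
    refine Polynomial.eq_of_infinite_eval_eq _ _ ?_
    have : {x | p.eval x = (Polynomial.C (μ.real (Metric.ball (0:E) 1))).eval x} ∈ 𝓝[>] (0:ℝ) := by
      filter_upwards [hev] with t ht
      simpa using ht
    obtain ⟨u, hu, hsub⟩ := mem_nhdsGT_iff_exists_Ioo_subset.1 this
    exact (Set.Ioo_infinite hu).mono hsub
  have hp1 := hp 1
  have h0 : ∫ x, (ContinuousLinearMap.id ℝ E + (1:ℝ) • fderiv ℝ h x).det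
      ∂(μ.restrict (Metric.ball 0 1)) = 0 := by
    rw [setIntegral_congr_fun (g := fun _ => (0:ℝ)) measurableSet_ball, integral_zero]
    intro x hx
    have hx' : ‖x‖ < 1 := by simpa using hx
    have hrd := (hr x hx'.le).differentiableAt one_ne_zero
    have : fderiv ℝ h x = fderiv ℝ r x - ContinuousLinearMap.id ℝ E :=
      (hrd.hasFDerivAt.sub (hasFDerivAt_id x)).fderiv
    simp only [this, one_smul, add_sub_cancel]
    refine det_zero r x hrd ?_
    filter_upwards [Metric.isOpen_ball.mem_nhds hx] with y hy
    exact h1 y (by simpa using (Metric.ball_subset_closedBall hy))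
  rw [h0, hpc, Polynomial.eval_C] at hp1
  have : 0 < μ.real (Metric.ball (0:E) 1) :=
    ENNReal.toReal_pos (Metric.measure_ball_pos μ 0 one_pos).ne' measure_ball_lt_top.ne
  linarith

lemma no_outward {E : Type*} [NormedAddCommGroup E] [InnerProductSpace ℝ E]
    [FiniteDimensional ℝ E] [MeasurableSpace E] [BorelSpace E]
    (w : E → E) (hw : ContDiff ℝ 1 w) (h0 : ∀ x, w x ≠ 0)
    (h1 : ∀ x, ‖x‖ = 1 → 0 < ⟪w x, x⟫) : False := by
  let d : E → ℝ := fun x => ⟪w x, x⟫ ^ 2 + (1 - ‖x‖ ^ 2) * ‖w x‖ ^ 2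
  let s : E → ℝ := fun x => (- ⟪w x, x⟫ + √(d x)) / ‖w x‖ ^ 2
  have hwp : ∀ x, 0 < ‖w x‖ ^ 2 := fun x => by have := norm_pos_iff.2 (h0 x); positivity
  have hd : ∀ x, ‖x‖ ≤ 1 → 0 < d x := by
    intro x hx
    rcases hx.eq_or_lt with hx | hx
    · have := h1 x hx
      simp only [d, hx]
      nlinarith
    · have : 0 < 1 - ‖x‖ ^ 2 := by nlinarith [norm_nonneg x]
      have := mul_pos this (hwp x)
      simp only [d]
      positivity
  have hi : ContDiff ℝ 1 fun x => ⟪w x, x⟫ := hw.inner ℝ contDiff_id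
  have hn : ContDiff ℝ 1 fun x => ‖w x‖ ^ 2 := hw.norm_sq ℝ
  have hdc : ContDiff ℝ 1 d := (hi.pow 2).add ((contDiff_const.sub (contDiff_norm_sq ℝ)).mul hn)
  refine no_retraction (fun x => x + s x • w x) ?_ ?_ ?_
  · intro x hx
    have hs : ContDiffAt ℝ 1 s x := by
      refine ContDiffAt.div ?_ hn.contDiffAt (hwp x).ne'
      exact hi.contDiffAt.neg.add (hdc.contDiffAt.sqrt (hd x hx).ne')
    exact contDiffAt_id.add (hs.smul hw.contDiffAt)
  · intro x hx
    have hsq := Real.sq_sqrt (hd x hx).le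
    have hne := (hwp x).ne'
    have : ‖x + s x • w x‖ ^ 2 = 1 := by
      rw [norm_add_sq_real, inner_smul_right, norm_smul, mul_pow, Real.norm_eq_abs, sq_abs,
        real_inner_comm]
      have hs : s x * ‖w x‖ ^ 2 = - ⟪w x, x⟫ + √(d x) := div_mul_cancel₀ _ hne
      have hd' : d x = ⟪w x, x⟫ ^ 2 + (1 - ‖x‖ ^ 2) * ‖w x‖ ^ 2 := rfl
      rw [hd'] at hsq
      rw [hd'] at hs
      have h3 : √(⟪w x, x⟫ ^ 2 + (1 - ‖x‖ ^ 2) * ‖w x‖ ^ 2) = s x * ‖w x‖ ^ 2 + ⟪w x, x⟫ := by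
        linarith
      rw [h3] at hsq
      apply mul_right_cancel₀ hne
      linear_combination hsq
    have h4 : 0 ≤ ‖x + s x • w x‖ := norm_nonneg _
    nlinarith
  · intro x hx
    have hdx : d x = ⟪w x, x⟫ ^ 2 := by simp [d, hx]
    have : s x = 0 := by
      simp only [s]
      rw [hdx, Real.sqrt_sq (h1 x hx).le]
      simp
    simp [this]

/-- Let `n ≥ 1`, `m ≤ n - 1`, and let `f : S^n → ℝ^m` be a continuous map. Then some
fiber of `f` has geodesic diameter at least `π/2`: there exist unit vectors `x, y`
with `f x = f y` and `⟪x, y⟫ ≤ 0` (i.e. geodesic distance `arccos ⟪x,y⟫ ≥ π/2`). -/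
theorem fiber_of_diameter_convexity_radius_sphere
    (n m : ℕ) (hn : 1 ≤ n) (hm : m ≤ n - 1)
    (f : EuclideanSpace ℝ (Fin (n + 1)) → EuclideanSpace ℝ (Fin m))
    (hf : ContinuousOn f (Metric.sphere 0 1)) :
    ∃ x y : EuclideanSpace ℝ (Fin (n + 1)), ‖x‖ = 1 ∧ ‖y‖ = 1 ∧
      f x = f y ∧ ⟪x, y⟫ ≤ 0 := by
  by_contra hcon
  push Not at hcon
  -- extend `f` continuously
  obtain ⟨f₁, hf₁⟩ := ContinuousMap.exists_restrict_eq
    (Metric.isClosed_sphere (x := (0 : EuclideanSpace ℝ (Fin (n + 1)))) (ε := 1))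
    ⟨_, hf.domRestrict⟩
  have hf₁' : ∀ x, ‖x‖ = 1 → f₁ x = f x := fun x hx => by
    have := congrArg (fun k => k ⟨x, by simpa using hx⟩) hf₁
    simpa using this
  -- uniform separation
  obtain ⟨δ, hδ, hsep⟩ : ∃ δ > 0, ∀ x y, ‖x‖ = 1 → ‖y‖ = 1 → dist (f₁ x) (f₁ y) < δ →
      0 < ⟪x, y⟫ := by
    let Q : Set (EuclideanSpace ℝ (Fin (n + 1)) × EuclideanSpace ℝ (Fin (n + 1))) :=
      (Metric.sphere 0 1 ×ˢ Metric.sphere 0 1) ∩ {z | ⟪z.1, z.2⟫ ≤ 0}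
    have hQ : IsCompact Q := ((isCompact_sphere _ _).prod (isCompact_sphere _ _)).inter_right
      (isClosed_le (continuous_fst.inner continuous_snd) continuous_const)
    have hc : Continuous fun z : EuclideanSpace ℝ (Fin (n + 1)) × EuclideanSpace ℝ (Fin (n + 1)) =>
        dist (f₁ z.1) (f₁ z.2) := by fun_prop
    rcases Q.eq_empty_or_nonempty with he | hne
    · refine ⟨1, one_pos, fun x y hx hy _ => ?_⟩
      by_contra hxy
      have : (x, y) ∈ Q := ⟨by simp [hx, hy], not_lt.1 hxy⟩
      simp [he] at this
    · obtain ⟨z, hz, hmin⟩ := hQ.exists_isMinOn hne hc.continuousOn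
      refine ⟨dist (f₁ z.1) (f₁ z.2), ?_, fun x y hx hy hxy => ?_⟩
      · rw [gt_iff_lt, dist_pos]
        intro heq
        have hz1 : ‖z.1‖ = 1 := by simpa using hz.1.1
        have hz2 : ‖z.2‖ = 1 := by simpa using hz.1.2
        rw [hf₁' _ hz1, hf₁' _ hz2] at heq
        exact absurd hz.2 (not_le.2 (hcon _ _ hz1 hz2 heq))
      · by_contra hxy'
        have : (x, y) ∈ Q := ⟨by simp [hx, hy], not_lt.1 hxy'⟩
        have h9 := isMinOn_iff.1 hmin _ this
        exact absurd hxy (not_lt.2 h9)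
  -- smooth approximation
  obtain ⟨F, hF, hFf, -⟩ := f₁.continuous.exists_contDiff_approx 1
    (ε := fun _ => δ / 4) continuous_const (fun _ => by positivity)
  have hFsep : ∀ x y, ‖x‖ = 1 → ‖y‖ = 1 → dist (F x) (F y) < δ / 2 → 0 < ⟪x, y⟫ := by
    intro x y hx hy hxy
    refine hsep x y hx hy ?_
    have h1 := hFf x
    have h2 := hFf y
    have h3 := dist_triangle4 (f₁ x) (F x) (F y) (f₁ y)
    rw [dist_comm (f₁ x) (F x)] at h3
    linarith
  -- the center map
  obtain ⟨G, hG⟩ := exists_contMDiffMap_forall_mem_convex_of_local_const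
    (n := 1) (modelWithCornersSelf ℝ (EuclideanSpace ℝ (Fin m)))
    (t := fun y => {v : EuclideanSpace ℝ (Fin (n + 1)) | ∀ x, ‖x‖ = 1 → F x = y → 0 < ⟪v, x⟫})
    (by
      intro y u hu v hv a b ha hb hab x hx hxy
      have h1 := hu x hx hxy
      have h2 := hv x hx hxy
      rw [inner_add_left, real_inner_smul_left, real_inner_smul_left]
      rcases ha.eq_or_lt with rfl | ha
      · have : b = 1 := by linarith
        subst this; simpa using h2
      · have := mul_pos ha h1
        have := mul_nonneg hb h2.le
        linarith)
    (by
      intro y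
      by_cases hp : ∃ q, ‖q‖ = 1 ∧ dist (F q) y < δ / 4
      · obtain ⟨q, hq, hqy⟩ := hp
        refine ⟨q, ?_⟩
        filter_upwards [Metric.ball_mem_nhds y (show 0 < δ / 4 by positivity)] with y' hy' x hx hxy
        refine hFsep q x hq hx ?_
        have := dist_triangle (F q) y (F x)
        rw [hxy, dist_comm y] at this
        rw [hxy]
        have h5 : dist y' y < δ / 4 := hy'
        linarith
      · refine ⟨0, ?_⟩
        filter_upwards [Metric.ball_mem_nhds y (show 0 < δ / 4 by positivity)] with y' hy' x hx hxy
        exact absurd ⟨x, hx, by rw [hxy]; exact hy'⟩ hp)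
  have hGc : ContDiff ℝ 1 G := G.contMDiff.contDiff
  have hFc : ContDiff ℝ 1 F := hF
  have hGF : ContDiff ℝ 1 fun x => G (F x) := hGc.comp hFc
  have hpos : ∀ x, ‖x‖ = 1 → 0 < ⟪G (F x), x⟫ := fun x hx => hG (F x) x hx rfl
  obtain ⟨ε, hε, hεpos⟩ : ∃ ε > 0, ∀ x, ‖x‖ = 1 → ε ≤ ⟪G (F x), x⟫ := by
    have hc : Continuous fun x => ⟪G (F x), x⟫ := hGF.continuous.inner continuous_id
    obtain ⟨z, hz, hmin⟩ := (isCompact_sphere (0 : EuclideanSpace ℝ (Fin (n + 1))) 1).exists_isMinOn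
      (NormedSpace.sphere_nonempty.2 zero_le_one) hc.continuousOn
    exact ⟨_, hpos z (by simpa using hz), fun x hx => hmin (by simpa using hx)⟩
  have hdense := hGc.dense_compl_range_of_finrank_lt_finrank (by
    simp only [finrank_euclideanSpace_fin]; omega)
  obtain ⟨v, hv, hvε⟩ := hdense.exists_dist_lt 0 hε
  refine no_outward (fun x => G (F x) - v) (hGF.sub contDiff_const) ?_ ?_
  · intro x hx
    exact hv ⟨F x, sub_eq_zero.1 hx⟩
  · intro x hx
    have h1 := hεpos x hx
    have h2 := real_inner_le_norm v x
    rw [hx, mul_one] at h2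
    rw [dist_zero_left] at hvε
    rw [inner_sub_left]
    linarith
end

section
/- Let C : [0,1] → ℝ³ be a continuous closed path on the unit sphere S² (so ‖C(t)‖ = 1 for all t and C(0) = C(1)) whose length (total variation) is at most 2π. Then C lies in a closed hemisphere: there exists a unit vector z ∈ ℝ³ such that ⟪z, C(t)⟫ ≥ 0 for all t ∈ [0,1]. -/
open scoped RealInnerProductSpace

open InnerProductGeometry in
lemma aux_angle_chord {x y : EuclideanSpace ℝ (Fin 3)} (hx : ‖x‖ = 1) (hy : ‖y‖ = 1) :
    (1 - ‖x - y‖ ^ 2 / 4) * angle x y ≤ ‖x - y‖ := by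
  obtain ⟨p, hp⟩ : ∃ p, p = angle x y / 2 := ⟨_, rfl⟩
  have h0 : 0 ≤ p := by have := angle_nonneg x y; linarith
  have h1 : p ≤ Real.pi / 2 := by have := angle_le_pi x y; linarith
  have hth : angle x y = 2 * p := by linarith
  have hs0 : 0 ≤ Real.sin p := Real.sin_nonneg_of_nonneg_of_le_pi h0 (by linarith [Real.pi_pos])
  have hc0 : 0 ≤ Real.cos p := Real.cos_nonneg_of_neg_pi_div_two_le_of_le (by linarith [Real.pi_pos]) h1
  have hsq : ‖x - y‖ ^ 2 = (2 * Real.sin p) ^ 2 := by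
    have h2 := norm_sub_sq_real x y
    have h3 := inner_eq_cos_angle_of_norm_eq_one hx hy
    rw [h3, hth, Real.cos_two_mul, hx, hy] at h2
    have := Real.sin_sq_add_cos_sq p
    linarith
  have hn : ‖x - y‖ = 2 * Real.sin p := by
    exact (pow_left_inj₀ (norm_nonneg _) (by positivity) two_ne_zero).1 hsq
  have hpc : p * Real.cos p ≤ Real.sin p := by
    rcases h1.lt_or_eq with h | h
    · have hc : 0 < Real.cos p := Real.cos_pos_of_mem_Ioo ⟨by linarith [Real.pi_pos], h⟩
      have := Real.le_tan h0 h
      rw [Real.tan_eq_sin_div_cos, le_div_iff₀ hc] at this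
      exact this
    · rw [h]; simp
  have hc1 := Real.cos_le_one p
  have := Real.sin_sq_add_cos_sq p
  have h5 : p * Real.cos p * Real.cos p ≤ p * Real.cos p * 1 :=
    mul_le_mul_of_nonneg_left hc1 (by positivity)
  rw [hn, hth]
  have h6 : (1 - (2 * Real.sin p) ^ 2 / 4) = Real.cos p * Real.cos p := by linarith
  rw [h6]
  linarith

open InnerProductGeometry in
lemma aux_angle_le (C : ℝ → EuclideanSpace ℝ (Fin 3)) (V : ℝ → ℝ → ℝ)
    (hC : ContinuousOn C (Set.Icc 0 1))
    (hsph : ∀ t ∈ Set.Icc (0 : ℝ) 1, ‖C t‖ = 1)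
    (hadd : ∀ a b c, 0 ≤ a → a ≤ b → b ≤ c → c ≤ 1 → V a b + V b c = V a c)
    (hd : ∀ a b, 0 ≤ a → a ≤ b → b ≤ 1 → ‖C a - C b‖ ≤ V a b)
    (a b : ℝ) (ha : 0 ≤ a) (hab : a ≤ b) (hb : b ≤ 1) : angle (C a) (C b) ≤ V a b := by
  have huc := isCompact_Icc.uniformContinuousOn_of_continuous hC
  rw [Metric.uniformContinuousOn_iff] at huc
  have key : ∀ η : ℝ, 0 < η → η ≤ 1 → (1 - η ^ 2 / 4) * angle (C a) (C b) ≤ V a b := by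
    intro η h0 h1
    obtain ⟨δ, hδ, hu⟩ := huc η h0
    obtain ⟨n, hn⟩ := exists_nat_gt ((b - a) / δ)
    have hnp : (0 : ℝ) < n := lt_of_le_of_lt (div_nonneg (by linarith) hδ.le) hn
    have hstep : (b - a) / n < δ := by
      rw [div_lt_iff₀ hδ] at hn
      rw [div_lt_iff₀ hnp]; linarith
    have hst0 : 0 ≤ (b - a) / n := div_nonneg (by linarith) hnp.le
    have hend : a + n * ((b - a) / n) = b := by field_simp; ring
    have ind : ∀ k : ℕ, k ≤ n → (1 - η ^ 2 / 4) * angle (C a) (C (a + k * ((b - a) / n))) ≤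
        V a (a + k * ((b - a) / n)) := by
      intro k
      induction k with
      | zero =>
        intro _
        have hn0 : C a ≠ 0 := by
          intro h; have := hsph a ⟨ha, by linarith⟩; rw [h] at this; simp at this
        simp only [Nat.cast_zero, zero_mul, add_zero, angle_self hn0, mul_zero]
        have := hd a a ha le_rfl (by linarith)
        simpa using this
      | succ k ih =>
        intro hk
        have ih := ih (by omega)
        have hkn : ((k + 1 : ℕ) : ℝ) ≤ n := by exact_mod_cast hk
        have hle : a + ((k + 1 : ℕ) : ℝ) * ((b - a) / n) ≤ b := by
          have := mul_le_mul_of_nonneg_right hkn hst0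
          linarith
        have hk0 : 0 ≤ (k : ℝ) * ((b - a) / n) := by positivity
        have hexp : a + ((k + 1 : ℕ) : ℝ) * ((b - a) / n) =
          (a + k * ((b - a) / n)) + (b - a) / n := by push_cast; ring
        rw [hexp] at hle ⊢
        set p := a + k * ((b - a) / n) with hp
        set d := (b - a) / n with hdd
        have hp1 : p ∈ Set.Icc (0:ℝ) 1 := ⟨by linarith, by linarith⟩
        have hq1 : p + d ∈ Set.Icc (0:ℝ) 1 := ⟨by linarith, by linarith⟩
        have hch : ‖C p - C (p + d)‖ < η := by
          rw [← dist_eq_norm]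
          apply hu p hp1 (p + d) hq1
          rw [Real.dist_eq]
          rw [abs_lt]; constructor <;> linarith
        have hA := aux_angle_chord (hsph p hp1) (hsph _ hq1)
        have hV := hd p (p + d) hp1.1 (by linarith) hq1.2
        have hsq : ‖C p - C (p + d)‖ ^ 2 ≤ η ^ 2 := pow_le_pow_left₀ (norm_nonneg _) hch.le 2
        have hB : (1 - η ^ 2 / 4) * angle (C p) (C (p + d)) ≤
            (1 - ‖C p - C (p + d)‖ ^ 2 / 4) * angle (C p) (C (p + d)) :=
          mul_le_mul_of_nonneg_right (by linarith) (angle_nonneg _ _)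
        have htri := angle_le_angle_add_angle (C a) (C p) (C (p + d))
        have hη : 0 ≤ 1 - η ^ 2 / 4 := by nlinarith
        have hT := mul_le_mul_of_nonneg_left htri hη
        have := hadd a p (p + d) ha (by linarith) (by linarith) hq1.2
        linarith
    have := ind n le_rfl
    rwa [hend] at this
  apply le_of_forall_pos_le_add
  intro ε hε
  have hη0 : 0 < min 1 (ε / Real.pi) := lt_min one_pos (div_pos hε Real.pi_pos)
  set η := min 1 (ε / Real.pi) with hη
  have hη1 : η ≤ 1 := min_le_left _ _
  have hη2 : η * Real.pi ≤ ε := by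
    have : η ≤ ε / Real.pi := min_le_right _ _
    rwa [le_div_iff₀ Real.pi_pos] at this
  have h := key η hη0 hη1
  have h2 : η ^ 2 / 4 * angle (C a) (C b) ≤ η * Real.pi :=
    mul_le_mul (by nlinarith) (angle_le_pi _ _) (angle_nonneg _ _) hη0.le
  linarith

lemma aux_eq_of_bessel {P X Y : EuclideanSpace ℝ (Fin 3)} (hP : ‖P‖ = 1) (hX : ‖X‖ = 1)
    (hY : ‖Y‖ = 1) (hPX : ⟪P, X⟫ = 0)
    (h : 1 ≤ ⟪P, Y⟫ ^ 2 + ⟪X, Y⟫ ^ 2) : Y = ⟪P, Y⟫ • P + ⟪X, Y⟫ • X := by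
  obtain ⟨a, ha⟩ : ∃ a, a = ⟪P, Y⟫ := ⟨_, rfl⟩
  obtain ⟨b, hb⟩ : ∃ b, b = ⟪X, Y⟫ := ⟨_, rfl⟩
  rw [← ha, ← hb] at h ⊢
  rw [← sub_eq_zero, ← inner_self_eq_zero (𝕜 := ℝ)]
  have e : ⟪Y - (a • P + b • X), Y - (a • P + b • X)⟫ = 1 - a ^ 2 - b ^ 2 := by
    simp only [inner_sub_left, inner_sub_right, inner_add_left, inner_add_right,
      real_inner_smul_left, real_inner_smul_right, real_inner_comm P X, real_inner_comm P Y,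
      real_inner_comm X Y, real_inner_self_eq_norm_sq, hY]
    rw [norm_smul, norm_smul, hP, hX, hPX, ← ha, ← hb, mul_one, mul_one, Real.norm_eq_abs,
      Real.norm_eq_abs, sq_abs, sq_abs]
    ring
  apply le_antisymm
  · linarith
  · exact real_inner_self_nonneg

open InnerProductGeometry in
/-- An arc of length at most `π` from `P` to `-P` is a half great circle. -/
lemma aux_semicircle {P X Y : EuclideanSpace ℝ (Fin 3)} (hP : ‖P‖ = 1) (hX : ‖X‖ = 1)
    (hY : ‖Y‖ = 1) (hPX : ⟪P, X⟫ = 0)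
    (h : angle P X + angle X Y + angle Y (-P) ≤ Real.pi ∨
      angle P Y + angle Y X + angle X (-P) ≤ Real.pi) :
    0 ≤ ⟪X, Y⟫ ∧ Y = ⟪P, Y⟫ • P + ⟪X, Y⟫ • X := by
  have hr := (inner_eq_zero_iff_angle_eq_pi_div_two P X).1 hPX
  have h0 := angle_nonneg P Y
  have h1 := angle_le_pi P Y
  have h2 := angle_nonneg X Y
  have h3 := angle_le_pi X Y
  have hs : Real.sin (angle P Y) ≤ ⟪X, Y⟫ := by
    rw [inner_eq_cos_angle_of_norm_eq_one hX hY]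
    rw [angle_neg_right, angle_neg_right, angle_comm Y X, angle_comm Y P, angle_comm X P, hr] at h
    rcases h with h | h
    · rw [← Real.cos_sub_pi_div_two]
      exact Real.cos_le_cos_of_nonneg_of_le_pi h2 (by linarith) (by linarith)
    · rw [← Real.cos_pi_div_two_sub]
      exact Real.cos_le_cos_of_nonneg_of_le_pi h2 (by linarith) (by linarith)
  have hs0 := sin_angle_nonneg P Y
  refine ⟨hs0.trans hs, aux_eq_of_bessel hP hX hY hPX ?_⟩
  rw [inner_eq_cos_angle_of_norm_eq_one hP hY]
  have := Real.sin_sq_add_cos_sq (angle P Y)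
  have := pow_le_pow_left₀ hs0 hs 2
  linarith

open InnerProductGeometry in
lemma aux_sum_le {P Q X : EuclideanSpace ℝ (Fin 3)} (hP : ‖P‖ = 1) (hX : ‖X‖ = 1)
    (hQ : ‖Q‖ = 1) (h : angle P X + angle X Q ≤ Real.pi) : 0 ≤ ⟪P + Q, X⟫ := by
  rw [inner_add_left, real_inner_comm X Q, inner_eq_cos_angle_of_norm_eq_one hP hX,
    inner_eq_cos_angle_of_norm_eq_one hX hQ]
  have := Real.cos_le_cos_of_nonneg_of_le_pi (angle_nonneg P X) 
    (by linarith [angle_nonneg X Q] : Real.pi - angle X Q ≤ Real.pi) (by linarith)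
  rw [Real.cos_pi_sub] at this
  linarith

lemma aux_perp (P X : EuclideanSpace ℝ (Fin 3)) :
    ∃ z : EuclideanSpace ℝ (Fin 3), ‖z‖ = 1 ∧ ⟪z, P⟫ = 0 ∧ ⟪z, X⟫ = 0 := by
  classical
  let K : Submodule ℝ (EuclideanSpace ℝ (Fin 3)) := Submodule.span ℝ (({P, X} : Finset _) : Set _)
  have hK : Module.finrank ℝ K ≤ 2 := by
    refine (finrank_span_finset_le_card ({P, X} : Finset (EuclideanSpace ℝ (Fin 3)))).trans ?_
    exact Finset.card_le_two
  have hne : Kᗮ ≠ ⊥ := by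
    intro h
    have h1 := Submodule.finrank_add_finrank_orthogonal K
    rw [h] at h1
    simp at h1
    omega
  obtain ⟨w, hw, hw0⟩ := Submodule.exists_mem_ne_zero_of_ne_bot hne
  have hwP : ⟪P, w⟫ = 0 := (Submodule.mem_orthogonal K w).1 hw P (Submodule.subset_span (by simp))
  have hwX : ⟪X, w⟫ = 0 := (Submodule.mem_orthogonal K w).1 hw X (Submodule.subset_span (by simp))
  refine ⟨‖w‖⁻¹ • w, norm_smul_inv_norm hw0, ?_, ?_⟩
  · rw [real_inner_smul_left, real_inner_comm, hwP, mul_zero]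
  · rw [real_inner_smul_left, real_inner_comm, hwX, mul_zero]

open InnerProductGeometry in
lemma aux_main (C : ℝ → EuclideanSpace ℝ (Fin 3)) (V : ℝ → ℝ → ℝ)
    (hC : ContinuousOn C (Set.Icc 0 1))
    (hsph : ∀ t ∈ Set.Icc (0 : ℝ) 1, ‖C t‖ = 1)
    (hclosed : C 0 = C 1)
    (hadd : ∀ a b c, 0 ≤ a → a ≤ b → b ≤ c → c ≤ 1 → V a b + V b c = V a c)
    (hang : ∀ a b, 0 ≤ a → a ≤ b → b ≤ 1 → angle (C a) (C b) ≤ V a b)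
    (T : ℝ) (hT0 : 0 ≤ T) (hT1 : T ≤ 1) (hV0 : V 0 T ≤ Real.pi) (hV1 : V T 1 ≤ Real.pi) :
    ∃ z : EuclideanSpace ℝ (Fin 3), ‖z‖ = 1 ∧ ∀ t ∈ Set.Icc (0 : ℝ) 1, 0 ≤ ⟪z, C t⟫ := by
  have hP := hsph 0 ⟨le_rfl, zero_le_one⟩
  have hQ := hsph T ⟨hT0, hT1⟩
  by_cases hz : C 0 + C T = 0
  · have hQP : C T = -C 0 := by rw [add_comm] at hz; exact eq_neg_of_add_eq_zero_left hz
    have hf : ContinuousOn (fun t => ⟪C 0, C t⟫) (Set.Icc 0 1) := continuousOn_const.inner hC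
    have e0 : ⟪C 0, C 0⟫ = 1 := by rw [real_inner_self_eq_norm_sq, hP]; norm_num
    have eT : ⟪C 0, C T⟫ = -1 := by rw [hQP, inner_neg_right, e0]
    have e1 : ⟪C 0, C 1⟫ = 1 := by rw [← hclosed, e0]
    obtain ⟨s, hs, hs'⟩ := intermediate_value_Icc' hT0
      (hf.mono (Set.Icc_subset_Icc le_rfl hT1)) (show (0:ℝ) ∈ Set.Icc _ _ from
        ⟨by simp only [eT]; norm_num, by simp only [e0]; norm_num⟩)
    obtain ⟨r, hr, hr'⟩ := intermediate_value_Icc hT1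
      (hf.mono (Set.Icc_subset_Icc hT0 le_rfl)) (show (0:ℝ) ∈ Set.Icc _ _ from
        ⟨by simp only [eT]; norm_num, by simp only [e1]; norm_num⟩)
    simp only at hs' hr'
    have hsX := hsph s ⟨hs.1, hs.2.trans hT1⟩
    have hrX := hsph r ⟨hT0.trans hr.1, hr.2⟩
    obtain ⟨z, hz1, hzP, hzX, hzR⟩ : ∃ z : EuclideanSpace ℝ (Fin 3), ‖z‖ = 1 ∧ ⟪z, C 0⟫ = 0 ∧
        ⟪z, C s⟫ = 0 ∧ 0 ≤ ⟪z, C r⟫ := by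
      obtain ⟨z, h1, h2, h3⟩ := aux_perp (C 0) (C s)
      rcases le_total 0 ⟪z, C r⟫ with h | h
      · exact ⟨z, h1, h2, h3, h⟩
      · exact ⟨-z, by rwa [norm_neg], by rw [inner_neg_left, h2, neg_zero],
          by rw [inner_neg_left, h3, neg_zero], by rw [inner_neg_left]; linarith⟩
    refine ⟨z, hz1, fun t ht => ?_⟩
    have htY := hsph t ht
    rcases le_total t T with htT | htT
    · have := (aux_semicircle hP hsX htY hs' (by
        rw [← hQP]
        rcases le_total s t with h | h
        · left
          have a1 := hang 0 s le_rfl hs.1 (by linarith [hs.2])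
          have a2 := hang s t hs.1 h ht.2
          have a3 := hang t T ht.1 htT hT1
          have b1 := hadd 0 s t le_rfl hs.1 h ht.2
          have b2 := hadd 0 t T le_rfl ht.1 htT hT1
          linarith
        · right
          have a1 := hang 0 t le_rfl ht.1 ht.2
          have a2 := hang t s ht.1 h (by linarith [hs.2])
          have a3 := hang s T hs.1 hs.2 hT1
          have b1 := hadd 0 t s le_rfl ht.1 h (by linarith [hs.2])
          have b2 := hadd 0 s T le_rfl hs.1 hs.2 hT1
          linarith)).2
      rw [this, inner_add_right, real_inner_smul_right, real_inner_smul_right, hzP, hzX]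
      simp
    · have := aux_semicircle hP hrX htY hr' (by
        rw [← hQP]
        have hr0 : 0 ≤ r := hT0.trans hr.1
        rcases le_total r t with h | h
        · right
          have a1 := hang T r hT0 hr.1 hr.2
          have a2 := hang r t hr0 h ht.2
          have a3 := hang t 1 ht.1 ht.2 le_rfl
          have b1 := hadd T r t hT0 hr.1 h ht.2
          have b2 := hadd T t 1 hT0 htT ht.2 le_rfl
          rw [← hclosed] at a3
          rw [angle_comm (C 0) (C t), angle_comm (C t) (C r), angle_comm (C r) (C T)]
          linarith
        · left
          have a1 := hang T t hT0 htT ht.2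
          have a2 := hang t r ht.1 h hr.2
          have a3 := hang r 1 hr0 hr.2 le_rfl
          have b1 := hadd T t r hT0 htT h hr.2
          have b2 := hadd T r 1 hT0 hr.1 hr.2 le_rfl
          rw [← hclosed] at a3
          rw [angle_comm (C 0) (C r), angle_comm (C r) (C t), angle_comm (C t) (C T)]
          linarith)
      rw [this.2, inner_add_right, real_inner_smul_right, real_inner_smul_right, hzP, mul_zero,
        zero_add]
      exact mul_nonneg this.1 hzR
  · refine ⟨‖C 0 + C T‖⁻¹ • (C 0 + C T), norm_smul_inv_norm hz, fun t ht => ?_⟩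
    rw [real_inner_smul_left]
    refine mul_nonneg (by positivity) ?_
    apply aux_sum_le hP (hsph t ht) hQ
    rcases le_total t T with htT | htT
    · have a1 := hang 0 t le_rfl ht.1 ht.2
      have a2 := hang t T ht.1 htT hT1
      have b1 := hadd 0 t T le_rfl ht.1 htT hT1
      linarith
    · have a1 := hang T t hT0 htT ht.2
      have a2 := hang t 1 ht.1 ht.2 le_rfl
      have b1 := hadd T t 1 hT0 htT ht.2 le_rfl
      rw [← hclosed] at a2
      rw [angle_comm (C 0) (C t), angle_comm (C t) (C T)]
      linarith

/-- A closed path on the unit sphere `S² ⊂ ℝ³` of length (total variation) at most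
`2π` lies in a closed hemisphere: there is a unit vector `z` with `⟪z, C t⟫ ≥ 0` for
all `t ∈ [0,1]`. -/
theorem closed_curve_length_le_two_pi_lies_in_hemisphere
    (C : ℝ → EuclideanSpace ℝ (Fin 3))
    (hC : ContinuousOn C (Set.Icc 0 1))
    (hsph : ∀ t ∈ Set.Icc (0 : ℝ) 1, ‖C t‖ = 1)
    (hclosed : C 0 = C 1)
    (hlen : eVariationOn C (Set.Icc 0 1) ≤ ENNReal.ofReal (2 * Real.pi)) :
    ∃ z : EuclideanSpace ℝ (Fin 3), ‖z‖ = 1 ∧ ∀ t ∈ Set.Icc (0 : ℝ) 1, 0 ≤ ⟪z, C t⟫ := by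
  obtain ⟨V, hV⟩ : ∃ V : ℝ → ℝ → ℝ, V = fun a b =>
    (eVariationOn C (Set.Icc 0 1 ∩ Set.Icc a b)).toReal := ⟨_, rfl⟩
  have hbv : BoundedVariationOn C (Set.Icc 0 1) := ne_top_of_le_ne_top ENNReal.ofReal_ne_top hlen
  have hfin : ∀ a b, eVariationOn C (Set.Icc 0 1 ∩ Set.Icc a b) ≠ ⊤ := fun a b =>
    hbv.mono Set.inter_subset_left
  have hadd : ∀ a b c, 0 ≤ a → a ≤ b → b ≤ c → c ≤ 1 → V a b + V b c = V a c := by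
    intro a b c h0 hab hbc h1
    simp only [hV]
    rw [← ENNReal.toReal_add (hfin _ _) (hfin _ _), eVariationOn.Icc_add_Icc C (s := Set.Icc 0 1) hab hbc
      ⟨by linarith, by linarith⟩]
  have hd : ∀ a b, 0 ≤ a → a ≤ b → b ≤ 1 → ‖C a - C b‖ ≤ V a b := by
    intro a b h0 hab h1
    simp only [hV]
    rw [← dist_eq_norm]
    have hb : BoundedVariationOn C (Set.Icc 0 1 ∩ Set.Icc a b) := hfin a b
    exact hb.dist_le ⟨⟨h0, hab.trans h1⟩, le_rfl, hab⟩ ⟨⟨h0.trans hab, h1⟩, hab, le_rfl⟩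
  have hV0 : ∀ a b, 0 ≤ V a b := fun a b => by simp only [hV]; exact ENNReal.toReal_nonneg
  have hcont : ContinuousOn (fun t => V 0 t) (Set.Icc 0 1) := by
    intro x hx
    have l := hbv.tendsto_eVariationOn_Icc_zero_left
      ((hC x hx).mono (Set.inter_subset_left (t := Set.Iic x)))
    have r := hbv.tendsto_eVariationOn_Icc_zero_right x
      ((hC x hx).mono (Set.inter_subset_left (t := Set.Ici x)))
    have l' := (ENNReal.tendsto_toReal ENNReal.zero_ne_top).comp l
    have r' := (ENNReal.tendsto_toReal ENNReal.zero_ne_top).comp r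
    have s := l'.add r'
    simp only [ENNReal.toReal_zero, add_zero] at s
    unfold ContinuousWithinAt
    rw [tendsto_iff_dist_tendsto_zero]
    refine squeeze_zero' (Filter.Eventually.of_forall fun _ => dist_nonneg) ?_ s
    filter_upwards [self_mem_nhdsWithin] with y hy
    change _ ≤ (eVariationOn C (Set.Icc 0 1 ∩ Set.Icc y x)).toReal +
      (eVariationOn C (Set.Icc 0 1 ∩ Set.Icc x y)).toReal
    have e1 : (eVariationOn C (Set.Icc 0 1 ∩ Set.Icc y x)).toReal = V y x := by rw [hV]
    have e2 : (eVariationOn C (Set.Icc 0 1 ∩ Set.Icc x y)).toReal = V x y := by rw [hV]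
    rw [e1, e2, Real.dist_eq, abs_le]
    have p1 := hV0 x y
    have p2 := hV0 y x
    rcases le_total x y with h | h
    · have := hadd 0 x y le_rfl hx.1 h hy.2
      constructor <;> linarith
    · have := hadd 0 y x le_rfl hy.1 h hx.2
      constructor <;> linarith
  have h01 : V 0 1 ≤ 2 * Real.pi := by
    simp only [hV, Set.inter_self]
    exact ENNReal.toReal_le_of_le_ofReal (by positivity) hlen
  have h00 : V 0 0 = 0 := by
    have := hadd 0 0 0 le_rfl le_rfl le_rfl zero_le_one
    linarith
  obtain ⟨T, hT, hT'⟩ := intermediate_value_Icc zero_le_one hcont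
    (show V 0 1 / 2 ∈ Set.Icc (V 0 0) (V 0 1) from
      ⟨by rw [h00]; linarith [hV0 0 1], by linarith [hV0 0 1]⟩)
  simp only at hT'
  have := hadd 0 T 1 le_rfl hT.1 hT.2 le_rfl
  exact aux_main C V hC hsph hclosed hadd
    (aux_angle_le C V hC hsph hadd hd) T hT.1 hT.2 (by linarith) (by linarith)
end

section
/- Crofton-type probability bound: let n ≥ 1, let γ : [0,1] → ℝ^{n+1} be a continuous path on the unit sphere S^n (‖γ(t)‖ = 1 for all t) of length L, and let σ be the uniform probability measure on S^n. Then the σ-measure of the set of poles whose equator meets γ, namely {v ∈ S^n : ∃ t ∈ [0,1], ⟪v, γ(t)⟫ = 0}, is at most L/π. -/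
open scoped RealInnerProductSpace MeasureTheory

section CroftonAux
open MeasureTheory Set Filter Topology

/-- Radial normalization is 2-Lipschitz outside of the unit ball. -/
lemma crofton_normalize {E : Type*} [NormedAddCommGroup E] [NormedSpace ℝ E]
    (x y : E) (hx : 1 ≤ ‖x‖) (hy : 1 ≤ ‖y‖) :
    ‖‖x‖⁻¹ • x - ‖y‖⁻¹ • y‖ ≤ 2 * ‖x - y‖ := by
  have h1 : ‖x‖⁻¹ • x - ‖y‖⁻¹ • y = ‖x‖⁻¹ • (x - y) + (‖x‖⁻¹ - ‖y‖⁻¹) • y := by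
    module
  have hx0 : 0 < ‖x‖ := by linarith
  have hy0 : 0 < ‖y‖ := by linarith
  have hxi : ‖x‖⁻¹ ≤ 1 := inv_le_one_of_one_le₀ hx
  have h2 : ‖‖x‖⁻¹ • (x - y)‖ ≤ ‖x - y‖ := by
    rw [norm_smul, norm_inv, norm_norm]
    exact mul_le_of_le_one_left (norm_nonneg _) hxi
  have h3 : ‖(‖x‖⁻¹ - ‖y‖⁻¹) • y‖ ≤ ‖x - y‖ := by
    have : (‖x‖⁻¹ - ‖y‖⁻¹) = ‖x‖⁻¹ * ‖y‖⁻¹ * (‖y‖ - ‖x‖) := by field_simp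
    rw [norm_smul, this, norm_mul, norm_mul, norm_inv, norm_inv, norm_norm, norm_norm]
    have h4 : ‖‖y‖ - ‖x‖‖ ≤ ‖x - y‖ := by
      rw [norm_sub_rev x y]; exact abs_norm_sub_norm_le y x
    calc ‖x‖⁻¹ * ‖y‖⁻¹ * ‖‖y‖ - ‖x‖‖ * ‖y‖ = ‖x‖⁻¹ * ‖‖y‖ - ‖x‖‖ := by field_simp
      _ ≤ 1 * ‖x - y‖ := by gcongr
      _ = _ := one_mul _
  rw [h1]
  linarith [norm_add_le (‖x‖⁻¹ • (x - y)) ((‖x‖⁻¹ - ‖y‖⁻¹) • y)]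

/-- Set of unit vectors in the boundary of a dual cone, in an open hemisphere. -/
lemma crofton_null_hemi (n : ℕ) (G : Set (EuclideanSpace ℝ (Fin (n + 1))))
    (hG : ∀ g ∈ G, g ≠ 0) (e : EuclideanSpace ℝ (Fin (n + 1))) (he : ‖e‖ = 1) :
    μH[n] {v : EuclideanSpace ℝ (Fin (n + 1)) | ‖v‖ = 1 ∧ 0 < ⟪v, e⟫ ∧
      (∀ g ∈ G, 0 ≤ ⟪v, g⟫) ∧ ∃ g ∈ G, ⟪v, g⟫ = 0} = 0 := by
  set H : Submodule ℝ (EuclideanSpace ℝ (Fin (n + 1))) := (ℝ ∙ e)ᗮ with hH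
  have he0 : e ≠ 0 := by rintro rfl; simp at he
  have hfin : Module.finrank ℝ H = n := by
    have : Fact (Module.finrank ℝ (EuclideanSpace ℝ (Fin (n + 1))) = n + 1) := ⟨by simp⟩
    exact Submodule.finrank_orthogonal_span_singleton he0
  have horth : ∀ y : H, ⟪e, (y : EuclideanSpace ℝ (Fin (n + 1)))⟫ = 0 := fun y =>
    Submodule.mem_orthogonal_singleton_iff_inner_right.1 y.2
  let K : Set H := {y | ∀ g ∈ G, 0 ≤ ⟪e + (y : EuclideanSpace ℝ (Fin (n + 1))), g⟫}
  have hK : Convex ℝ K := by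
    intro x hx y hy a b ha hb hab g hg
    have h1 := hx g hg
    have h2 := hy g hg
    simp only [inner_add_left, Submodule.coe_add, Submodule.coe_smul, inner_smul_left,
      RCLike.conj_to_real] at h1 h2 ⊢
    have hb' : b = 1 - a := by linarith
    subst hb'
    nlinarith [mul_nonneg ha h1, mul_nonneg hb h2]
  have hfr : μH[n] (frontier K) = 0 := by
    have := hK.addHaar_frontier (μH[Module.finrank ℝ H])
    rwa [hfin] at this
  let F : H → EuclideanSpace ℝ (Fin (n + 1)) := fun y =>
    ‖e + (y : EuclideanSpace ℝ (Fin (n + 1)))‖⁻¹ • (e + (y : EuclideanSpace ℝ (Fin (n + 1))))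
  have hge : ∀ y : H, 1 ≤ ‖e + (y : EuclideanSpace ℝ (Fin (n + 1)))‖ := by
    intro y
    have h1 := norm_add_sq_real e (y : EuclideanSpace ℝ (Fin (n + 1)))
    rw [horth y, he] at h1
    have := norm_nonneg (e + (y : EuclideanSpace ℝ (Fin (n + 1))))
    nlinarith [sq_nonneg ‖(y : EuclideanSpace ℝ (Fin (n + 1)))‖]
  have hF : LipschitzWith 2 F := by
    refine LipschitzWith.of_dist_le_mul fun x y => ?_
    rw [dist_eq_norm, dist_eq_norm]
    refine (crofton_normalize _ _ (hge x) (hge y)).trans ?_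
    simp
  have himg : μH[n] (F '' frontier K) = 0 := by
    have := hF.hausdorffMeasure_image_le (Nat.cast_nonneg n) (frontier K)
    rw [hfr, mul_zero] at this
    exact le_antisymm this (zero_le)
  refine measure_mono_null ?_ himg
  rintro v ⟨hv, hve, hpos, g, hg, hvg⟩
  set c := ⟪v, e⟫ with hc
  let y : H := ⟨c⁻¹ • v - e, by
    rw [hH, Submodule.mem_orthogonal_singleton_iff_inner_right, inner_sub_right, inner_smul_right,
      real_inner_self_eq_norm_sq, he, real_inner_comm, ← hc]
    field_simp; norm_num⟩
  have hy : e + (y : EuclideanSpace ℝ (Fin (n + 1))) = c⁻¹ • v := by simp [y]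
  refine ⟨y, ?_, ?_⟩
  · refine ⟨subset_closure ?_, ?_⟩
    · intro g' hg'
      rw [hy, inner_smul_left]
      exact mul_nonneg (by simpa using hve.le) (hpos g' hg')
    · intro hint
      let h : H := H.orthogonalProjectionOnto g
      have hcont : Tendsto (fun ε : ℝ => y - ε • h) (𝓝[>] 0) (𝓝 y) := by
        have : Continuous (fun ε : ℝ => y - ε • h) := by fun_prop
        have := this.tendsto 0
        simp only [zero_smul, sub_zero] at this
        exact this.mono_left nhdsWithin_le_nhds
      have hev := hcont.eventually (mem_interior_iff_mem_nhds.1 hint)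
      obtain ⟨ε, hεK, hε⟩ := (hev.and self_mem_nhdsWithin).exists
      have h1 := hεK g hg
      have h2 : ⟪(h : EuclideanSpace ℝ (Fin (n + 1))), g⟫ = ‖h‖ ^ 2 := by
        rw [← real_inner_self_eq_norm_sq]
        exact (Submodule.inner_orthogonalProjectionOnto_eq_of_mem_left h g).symm
      have h3 : e + ((y - ε • h : H) : EuclideanSpace ℝ (Fin (n + 1))) = c⁻¹ • v - ε • (h : EuclideanSpace ℝ (Fin (n + 1))) := by
        rw [← hy]; simp; abel
      rw [h3, inner_sub_left, inner_smul_left, inner_smul_left, hvg, h2] at h1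
      simp only [RCLike.conj_to_real, mul_zero, zero_sub] at h1
      have hε' : (0 : ℝ) < ε := hε
      have h4 : ‖h‖ = 0 := by
        by_contra hne
        have : 0 < ‖h‖ ^ 2 := by positivity
        nlinarith
      have h5 : g ∈ Hᗮ := by
        rw [← Submodule.orthogonalProjectionOnto_eq_zero_iff]
        exact norm_eq_zero.1 h4
      rw [hH, Submodule.orthogonal_orthogonal, Submodule.mem_span_singleton] at h5
      obtain ⟨a, rfl⟩ := h5
      rw [inner_smul_right, ← hc] at hvg
      rcases mul_eq_zero.1 hvg with h6 | h6
      · exact hG _ hg (by simp [h6])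
      · exact hve.ne' h6
  · simp only [F, hy, norm_smul, hv, norm_inv, Real.norm_of_nonneg hve.le]
    rw [smul_smul]
    field_simp
    simp

lemma crofton_null (n : ℕ) (G : Set (EuclideanSpace ℝ (Fin (n + 1))))
    (hG : ∀ g ∈ G, g ≠ 0) :
    μH[n] {v : EuclideanSpace ℝ (Fin (n + 1)) | ‖v‖ = 1 ∧
      (∀ g ∈ G, 0 ≤ ⟪v, g⟫) ∧ ∃ g ∈ G, ⟪v, g⟫ = 0} = 0 := by
  let b := EuclideanSpace.basisFun (Fin (n + 1)) ℝ
  have h1 : ∀ i, ‖b i‖ = 1 := fun i => b.orthonormal.1 i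
  have key := (measure_iUnion_null (fun i => crofton_null_hemi n G hG (b i) (h1 i)))
  have key' := (measure_iUnion_null (fun i => crofton_null_hemi n G hG (-b i) (by simp [h1 i])))
  refine measure_mono_null ?_ (measure_union_null key key')
  rintro v ⟨hv, h2, h3⟩
  have : ∃ i, ⟪v, b i⟫ ≠ 0 := by
    by_contra! hcon
    have : v = 0 := by
      rw [← b.sum_repr' v]
      refine Finset.sum_eq_zero fun i _ => ?_
      rw [real_inner_comm, hcon i, zero_smul]
    simp [this] at hv
  obtain ⟨i, hi⟩ := this
  rcases lt_or_gt_of_ne hi with h | h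
  · exact Or.inr (mem_iUnion.2 ⟨i, hv, by simpa using h, h2, h3⟩)
  · exact Or.inl (mem_iUnion.2 ⟨i, hv, h, h2, h3⟩)

end CroftonAux

section CroftonAux2
open MeasureTheory Set Filter Topology

lemma crofton_ivt (f : ℝ → ℝ) (hf : Continuous f) (a b : ℝ) (hab : a ≤ b) (h : f a * f b < 0) :
    ∃ s ∈ Ioo a b, f s = 0 := by
  rcases mul_neg_iff.1 h with ⟨h1, h2⟩ | ⟨h1, h2⟩
  · exact intermediate_value_Ioo' hab hf.continuousOn ⟨h2, h1⟩
  · exact intermediate_value_Ioo hab hf.continuousOn ⟨h1, h2⟩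

lemma crofton_trig (P Q a b c d : ℝ) (hab : a ≤ b) (hbc : b ≤ c) (hcd : c ≤ d) (hda : d - a ≤ Real.pi)
    (h1 : (P * Real.cos a + Q * Real.sin a) * (P * Real.cos b + Q * Real.sin b) < 0)
    (h2 : (P * Real.cos c + Q * Real.sin c) * (P * Real.cos d + Q * Real.sin d) < 0) : False := by
  have hf : Continuous (fun s => P * Real.cos s + Q * Real.sin s) := by fun_prop
  obtain ⟨s, hs, hs0⟩ := crofton_ivt _ hf a b hab h1
  obtain ⟨t, ht, ht0⟩ := crofton_ivt _ hf c d hcd h2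
  simp only [mem_Ioo] at hs ht
  have hsin : 0 < Real.sin (t - s) := Real.sin_pos_of_pos_of_lt_pi (by linarith) (by linarith)
  rw [Real.sin_sub] at hsin
  have hP : P * (Real.sin t * Real.cos s - Real.cos t * Real.sin s) = 0 := by
    linear_combination Real.sin t * hs0 - Real.sin s * ht0
  have hQ : Q * (Real.sin t * Real.cos s - Real.cos t * Real.sin s) = 0 := by
    linear_combination Real.cos s * ht0 - Real.cos t * hs0
  have hP0 : P = 0 := (mul_eq_zero.1 hP).resolve_right hsin.ne'
  have hQ0 : Q = 0 := (mul_eq_zero.1 hQ).resolve_right hsin.ne'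
  simp [hP0, hQ0] at h1

/-- unit vectors whose equator strictly separates `a` and `b`. -/
def croftonW (n : ℕ) (a b : EuclideanSpace ℝ (Fin (n + 1))) :
    Set (EuclideanSpace ℝ (Fin (n + 1))) :=
  {v | ‖v‖ = 1 ∧ ⟪v, a⟫ * ⟪v, b⟫ < 0}

lemma crofton_W_meas (n : ℕ) (a b : EuclideanSpace ℝ (Fin (n + 1))) :
    MeasurableSet (croftonW n a b) := by
  have h1 : MeasurableSet {v : EuclideanSpace ℝ (Fin (n + 1)) | ‖v‖ = 1} :=
    (isClosed_eq (by fun_prop) (by fun_prop)).measurableSet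
  have h2 : MeasurableSet {v : EuclideanSpace ℝ (Fin (n + 1)) | ⟪v, a⟫ * ⟪v, b⟫ < 0} :=
    (isOpen_lt (by fun_prop) (by fun_prop)).measurableSet
  exact h1.inter h2

lemma crofton_wedge (n : ℕ) (p q : EuclideanSpace ℝ (Fin (n + 1))) (hp : ‖p‖ = 1) (hq : ‖q‖ = 1)
    (hpq : ⟪p, q⟫ = 0) (θ : ℝ) (hθ : 0 ≤ θ) (k : ℕ) (hk : k * θ ≤ Real.pi) :
    k * μH[n] (croftonW n p (Real.cos θ • p + Real.sin θ • q)) ≤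
      μH[n] (Metric.sphere (0 : EuclideanSpace ℝ (Fin (n + 1))) 1) := by
  set u : ℝ → EuclideanSpace ℝ (Fin (n + 1)) := fun s => Real.cos s • p + Real.sin s • q with hu
  have hin : ∀ s t, ⟪u s, u t⟫ = Real.cos (s - t) := by
    intro s t
    simp only [hu, inner_add_left, inner_add_right, inner_smul_left, inner_smul_right,
      real_inner_self_eq_norm_sq, hp, hq, hpq, real_inner_comm p q, RCLike.conj_to_real, Real.cos_sub]
    ring
  have hn1 : ∀ s, ‖u s‖ = 1 := by
    intro s
    have := hin s s
    rw [real_inner_self_eq_norm_sq, sub_self, Real.cos_zero] at this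
    nlinarith [norm_nonneg (u s)]
  have hrefl : ∀ ψ s, (ℝ ∙ u ψ).reflection (u s) = u (2 * ψ - s) := by
    intro ψ s
    rw [Submodule.reflection_singleton_apply, hin, hn1]
    have hψs : 2 * ψ - s = ψ + (ψ - s) := by ring
    have hs : s = ψ - (ψ - s) := by ring
    rw [hψs]
    conv_lhs => rw [show u s = u (ψ - (ψ - s)) by rw [← hs]]
    generalize ψ - s = r
    simp only [hu, Real.cos_add, Real.sin_add, Real.cos_sub, Real.sin_sub, RCLike.ofReal_real_eq_id, id]
    module
  have hmeq : ∀ j : ℕ, μH[n] (croftonW n (u (j * θ)) (u ((j + 1) * θ))) =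
      μH[n] (croftonW n p (u θ)) := by
    intro j
    let R := (ℝ ∙ u ((j + 1) * θ / 2)).reflection
    have hR : R.toIsometryEquiv ⁻¹' (croftonW n (u (j * θ)) (u ((j + 1) * θ))) =
        croftonW n p (u θ) := by
      ext v
      have h0 : u 0 = p := by simp [hu]
      have e1 : u (j * θ) = R (u θ) := by
        rw [hrefl]; congr 1; ring
      have e2 : u ((j + 1) * θ) = R (u 0) := by
        rw [hrefl]; congr 1; ring
      have e3 : ∀ w, ⟪R v, R w⟫ = ⟪v, w⟫ := fun w => R.inner_map_map v w
      simp only [mem_preimage, croftonW, mem_ofPred_eq, LinearIsometryEquiv.coe_toIsometryEquiv]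
      rw [e1, e2, e3, e3, R.norm_map, h0, mul_comm]
    rw [← hR, IsometryEquiv.hausdorffMeasure_preimage]
  have hdisj : (↑(Finset.range k) : Set ℕ).PairwiseDisjoint
      (fun j : ℕ => croftonW n (u (j * θ)) (u ((j + 1) * θ))) := by
    have aux : ∀ i j : ℕ, i < j → j < k → ∀ v, v ∈ croftonW n (u (i * θ)) (u ((i + 1) * θ)) →
        v ∈ croftonW n (u (j * θ)) (u ((j + 1) * θ)) → False := by
      intro i j hij hjk v hvi hvj
      have h1 := hvi.2
      have h2 := hvj.2
      simp only [hu, inner_add_right, inner_smul_right] at h1 h2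
      have hij' : (i : ℝ) + 1 ≤ j := by exact_mod_cast hij
      have hjk' : (j : ℝ) + 1 ≤ k := by exact_mod_cast hjk
      refine crofton_trig ⟪v, p⟫ ⟪v, q⟫ (i * θ) ((i + 1) * θ) (j * θ) ((j + 1) * θ) ?_ ?_ ?_ ?_ ?_ ?_
      · nlinarith
      · nlinarith
      · nlinarith
      · have : 0 ≤ (i : ℝ) * θ := by positivity
        nlinarith
      · convert h1 using 1; ring
      · convert h2 using 1; ring
    intro i hi j hj hij
    rw [Function.onFun, Set.disjoint_left]
    intro v hvi hvj
    simp only [Finset.coe_range, mem_Iio] at hi hj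
    rcases lt_or_gt_of_ne hij with h | h
    · exact aux i j h hj v hvi hvj
    · exact aux j i h hi v hvj hvi
  have hsum := measure_biUnion_finset (μ := μH[(n : ℝ)]) hdisj (fun j _ => crofton_W_meas n _ _)
  simp only [hmeq, Finset.sum_const, Finset.card_range, nsmul_eq_mul] at hsum
  change (k : ENNReal) * μH[n] (croftonW n p (u θ)) ≤ _
  rw [← hsum]
  refine measure_mono (iUnion₂_subset fun j _ v hv => ?_)
  simpa using hv.1

lemma crofton_small (n : ℕ) (c : ℝ) (hc : 1 / Real.pi < c) :
    ∃ δ > 0, ∀ a b : EuclideanSpace ℝ (Fin (n + 1)), ‖a‖ = 1 → ‖b‖ = 1 → dist a b < δ →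
      μH[n] (croftonW n a b) ≤ ENNReal.ofReal c * edist a b *
        μH[n] (Metric.sphere (0 : EuclideanSpace ℝ (Fin (n + 1))) 1) := by
  have hπ := Real.pi_pos
  have hc0 : 0 < c := lt_trans (by positivity) hc
  -- a small angle
  obtain ⟨η, hη0, hη⟩ : ∃ η > 0, ∀ θ : ℝ, |θ| < η → 1 < c * (1 - θ ^ 2 / 24) * (Real.pi - θ) := by
    have hcont : Continuous (fun θ : ℝ => c * (1 - θ ^ 2 / 24) * (Real.pi - θ)) := by fun_prop
    have h0 : 1 < c * (1 - (0 : ℝ) ^ 2 / 24) * (Real.pi - 0) := by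
      rw [div_lt_iff₀ hπ] at hc
      simpa using hc
    have := (hcont.tendsto 0).eventually (lt_mem_nhds h0)
    obtain ⟨η, hη0, h⟩ := Metric.eventually_nhds_iff.1 this
    exact ⟨η, hη0, fun θ hθ => h (by simpa [Real.dist_eq] using hθ)⟩
  refine ⟨min (η / 2) 1 / 2, by positivity, fun a b ha hb hab => ?_⟩
  rcases eq_or_ne a b with rfl | hne
  · have : croftonW n a a = ∅ := by
      ext v
      simp only [croftonW, mem_ofPred_eq, mem_empty_iff_false, iff_false, not_and, not_lt]
      intro _
      exact mul_self_nonneg _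
    simp [this]
  set θ := InnerProductGeometry.angle a b with hθ
  have hcos : ⟪a, b⟫ = Real.cos θ := by
    rw [hθ, InnerProductGeometry.cos_angle, ha, hb]; simp
  have hθ0 : 0 ≤ θ := InnerProductGeometry.angle_nonneg _ _
  have hθπ : θ ≤ Real.pi := InnerProductGeometry.angle_le_pi _ _
  have hdist : dist a b = 2 * Real.sin (θ / 2) := by
    have h1 : dist a b ^ 2 = (2 * Real.sin (θ / 2)) ^ 2 := by
      rw [dist_eq_norm, norm_sub_sq_real, ha, hb, hcos]
      have h2 := Real.cos_two_mul (θ / 2)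
      have h3 := Real.sin_sq_add_cos_sq (θ / 2)
      rw [show 2 * (θ / 2) = θ by ring] at h2
      nlinarith
    have h4 : 0 ≤ Real.sin (θ / 2) := Real.sin_nonneg_of_nonneg_of_le_pi (by linarith) (by linarith)
    exact (sq_eq_sq₀ dist_nonneg (by positivity)).1 h1
  have hθle : θ ≤ 2 * dist a b := by
    have h1 := Real.mul_le_sin (x := θ / 2) (by linarith) (by linarith)
    have h2 : 1 / 2 ≤ 2 / Real.pi := by
      rw [div_le_div_iff₀ (by norm_num) hπ]; linarith [Real.pi_le_four]
    rw [hdist]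
    nlinarith
  have hθη : θ < η := by
    have := min_le_left (η / 2) 1
    linarith
  have hθ1 : θ < 1 := by
    have := min_le_right (η / 2) 1
    linarith
  have hθpos : 0 < θ := by
    rcases hθ0.eq_or_lt with h | h
    · exfalso
      rw [← h] at hdist
      simp at hdist
      exact hne hdist
    · exact h
  have hkey := hη θ (by rwa [abs_of_nonneg hθ0])
  have hsinθ : 0 < Real.sin θ :=
    Real.sin_pos_of_pos_of_lt_pi hθpos (by linarith [Real.pi_gt_three])
  set q := (Real.sin θ)⁻¹ • (b - Real.cos θ • a) with hq
  have hbeq : b = Real.cos θ • a + Real.sin θ • q := by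
    rw [hq, smul_smul, mul_inv_cancel₀ hsinθ.ne', one_smul]; abel
  have haq : ⟪a, q⟫ = 0 := by
    rw [hq, inner_smul_right, inner_sub_right, inner_smul_right, real_inner_self_eq_norm_sq, ha, hcos]
    ring
  have hqn : ‖q‖ = 1 := by
    have h1 : ‖b - Real.cos θ • a‖ ^ 2 = Real.sin θ ^ 2 := by
      rw [norm_sub_sq_real, inner_smul_right, real_inner_comm, hcos, norm_smul, ha, hb,
        Real.norm_eq_abs, mul_one, sq_abs]
      nlinarith [Real.sin_sq_add_cos_sq θ]
    have h2 : ‖b - Real.cos θ • a‖ = Real.sin θ :=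
      (sq_eq_sq₀ (norm_nonneg _) hsinθ.le).1 h1
    rw [hq, norm_smul, h2, norm_inv, Real.norm_of_nonneg hsinθ.le, inv_mul_cancel₀ hsinθ.ne']
  have hw := crofton_wedge n a q ha hqn haq θ hθ0 ⌊Real.pi / θ⌋₊ (by
    have := Nat.floor_le (a := Real.pi / θ) (by positivity)
    rwa [le_div_iff₀ hθpos] at this)
  rw [← hbeq] at hw
  set M := μH[n] (Metric.sphere (0 : EuclideanSpace ℝ (Fin (n + 1))) 1) with hM
  set m := μH[n] (croftonW n a b) with hm
  have hfl : Real.pi / θ - 1 ≤ (⌊Real.pi / θ⌋₊ : ℝ) := (Nat.sub_one_lt_floor _).le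
  have hcd : 1 ≤ c * dist a b * (⌊Real.pi / θ⌋₊ : ℝ) := by
    have h1 : θ * (1 - θ ^ 2 / 24) ≤ dist a b := by
      have := Real.sin_gt_sub_cube (x := θ / 2) (by positivity)
      rw [hdist]; nlinarith
    have h2 : 0 ≤ Real.pi / θ - 1 := by
      rw [sub_nonneg, le_div_iff₀ hθpos]; linarith [Real.pi_gt_three]
    calc (1 : ℝ) ≤ c * (1 - θ ^ 2 / 24) * (Real.pi - θ) := hkey.le
      _ = c * (θ * (1 - θ ^ 2 / 24)) * (Real.pi / θ - 1) := by field_simp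
      _ ≤ c * dist a b * (⌊Real.pi / θ⌋₊ : ℝ) := by
        have : 0 ≤ c * dist a b := by positivity
        gcongr
  calc m = ENNReal.ofReal 1 * m := by simp
    _ ≤ ENNReal.ofReal (c * dist a b * (⌊Real.pi / θ⌋₊ : ℝ)) * m := by gcongr
    _ = ENNReal.ofReal c * edist a b * (⌊Real.pi / θ⌋₊ * m) := by
      rw [ENNReal.ofReal_mul (by positivity), ENNReal.ofReal_mul hc0.le, edist_dist,
        ENNReal.ofReal_natCast, mul_assoc, mul_assoc]
    _ ≤ _ := by gcongr

end CroftonAux2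

section CroftonAux3
open MeasureTheory Set Filter Topology

/-- Points of the uniform partition of `[0,1]` in `k+1` pieces. -/
noncomputable def croftonU (k i : ℕ) : ℝ := min ((i : ℝ) / (k + 1)) 1

lemma crofton_U_mono (k : ℕ) : Monotone (croftonU k) := by
  intro i j hij
  unfold croftonU
  have : (i : ℝ) ≤ j := by exact_mod_cast hij
  gcongr

lemma crofton_U_mem (k i : ℕ) : croftonU k i ∈ Icc (0 : ℝ) 1 :=
  ⟨le_min (by positivity) zero_le_one, min_le_right _ _⟩

lemma crofton_U_dist (k i : ℕ) : dist (croftonU k (i + 1)) (croftonU k i) ≤ 1 / (k + 1) := by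
  have hk : (0 : ℝ) < (k : ℝ) + 1 := by positivity
  have h := crofton_U_mono k (Nat.le_succ i)
  rw [Real.dist_eq, abs_of_nonneg (by simpa using h)]
  unfold croftonU
  have h2 : (((i + 1 : ℕ) : ℝ)) / (k + 1) = (i : ℝ) / (k + 1) + 1 / (k + 1) := by
    push_cast; ring
  rw [h2]
  have h3 : (0 : ℝ) < 1 / ((k : ℝ) + 1) := by positivity
  rcases le_total ((i : ℝ) / (k + 1)) 1 with h4 | h4
  · rw [min_eq_left h4]; linarith [min_le_left ((i : ℝ) / (k + 1) + 1 / (k + 1)) 1]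
  · rw [min_eq_right h4]; linarith [min_le_right ((i : ℝ) / (k + 1) + 1 / (k + 1)) 1]

lemma crofton_U_near (k : ℕ) (s : ℝ) (hs : s ∈ Icc (0 : ℝ) 1) :
    ∃ i ≤ k + 1, |croftonU k i - s| ≤ 1 / (k + 1) := by
  have hk : (0 : ℝ) < (k : ℝ) + 1 := by positivity
  have hs0 : 0 ≤ s * (k + 1) := mul_nonneg hs.1 hk.le
  have h1 := Nat.floor_le hs0
  have h2 := Nat.lt_floor_add_one (s * ((k : ℝ) + 1))
  have h4 : ((⌊s * ((k : ℝ) + 1)⌋₊ : ℝ)) / (k + 1) ≤ s := by rwa [div_le_iff₀ hk]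
  refine ⟨⌊s * ((k : ℝ) + 1)⌋₊, ?_, ?_⟩
  · have : (⌊s * ((k : ℝ) + 1)⌋₊ : ℝ) ≤ ((k + 1 : ℕ) : ℝ) := by
      push_cast
      nlinarith [hs.2]
    exact_mod_cast this
  · unfold croftonU
    rw [min_eq_left (h4.trans hs.2), abs_of_nonpos (by linarith)]
    have : s < ((⌊s * ((k : ℝ) + 1)⌋₊ : ℝ) + 1) / (k + 1) := by rwa [lt_div_iff₀ hk]
    rw [add_div] at this
    linarith

lemma crofton_U_small (ε : ℝ) (hε : 0 < ε) : ∀ᶠ k : ℕ in atTop, 1 / ((k : ℝ) + 1) < ε :=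
  tendsto_one_div_add_atTop_nhds_zero_nat.eventually (gt_mem_nhds hε)

/-- A continuous function taking both signs changes sign along fine uniform partitions. -/
lemma crofton_sign (f : ℝ → ℝ) (hf : ContinuousOn f (Icc 0 1)) (hne : ∀ k i, f (croftonU k i) ≠ 0)
    (s t : ℝ) (hs : s ∈ Icc (0 : ℝ) 1) (ht : t ∈ Icc (0 : ℝ) 1) (hfs : f s < 0) (hft : 0 < f t) :
    ∀ᶠ k : ℕ in atTop, ∃ i ∈ Finset.range (k + 1), f (croftonU k i) * f (croftonU k (i + 1)) < 0 := by
  obtain ⟨ε₁, hε₁, h1⟩ := Metric.eventually_nhds_iff.1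
    (eventually_nhdsWithin_iff.1 ((hf s hs).eventually (gt_mem_nhds hfs)))
  obtain ⟨ε₂, hε₂, h2⟩ := Metric.eventually_nhds_iff.1
    (eventually_nhdsWithin_iff.1 ((hf t ht).eventually (lt_mem_nhds hft)))
  filter_upwards [crofton_U_small ε₁ hε₁, crofton_U_small ε₂ hε₂] with k hk1 hk2
  obtain ⟨i, hi, hi'⟩ := crofton_U_near k s hs
  obtain ⟨j, hj, hj'⟩ := crofton_U_near k t ht
  have hfi : f (croftonU k i) < 0 := h1 (by rw [Real.dist_eq]; linarith) (crofton_U_mem k i)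
  have hfj : 0 < f (croftonU k j) := h2 (by rw [Real.dist_eq]; linarith) (crofton_U_mem k j)
  by_contra! hcon
  have hind : ∀ m, m ≤ k + 1 → 0 < f (croftonU k 0) * f (croftonU k m) := by
    intro m
    induction m with
    | zero => intro _; exact mul_self_pos.2 (hne k 0)
    | succ m ih =>
      intro hm
      have h3 := ih (by omega)
      have h4 := hcon m (Finset.mem_range.2 (by omega))
      have h5 : 0 < f (croftonU k m) * f (croftonU k (m + 1)) :=
        lt_of_le_of_ne h4 (mul_ne_zero (hne _ _) (hne _ _)).symm
      have h6 := mul_pos h3 h5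
      have h7 : 0 < f (croftonU k m) * f (croftonU k m) := mul_self_pos.2 (hne k m)
      by_contra! h8
      nlinarith
  have h3 := hind i hi
  have h4 := hind j hj
  have h5 : f (croftonU k 0) < 0 := by
    by_contra! h; nlinarith
  nlinarith

lemma crofton_bound (n : ℕ)
    (γ : ℝ → EuclideanSpace ℝ (Fin (n + 1)))
    (hγ : ContinuousOn γ (Set.Icc 0 1))
    (hsph : ∀ t ∈ Set.Icc (0 : ℝ) 1, ‖γ t‖ = 1) (c : ℝ) (hc : 1 / Real.pi < c) :
    μH[n] ({v : EuclideanSpace ℝ (Fin (n + 1)) | ∃ t ∈ Set.Icc (0 : ℝ) 1, ⟪v, γ t⟫ = 0} ∩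
      Metric.sphere (0 : EuclideanSpace ℝ (Fin (n + 1))) 1) ≤
      ENNReal.ofReal c * eVariationOn γ (Set.Icc 0 1) *
        μH[n] (Metric.sphere (0 : EuclideanSpace ℝ (Fin (n + 1))) 1) := by
  have hγ0 : ∀ t ∈ Set.Icc (0 : ℝ) 1, γ t ≠ 0 := by
    intro t ht h
    have := hsph t ht
    simp [h] at this
  let T1 : Set (EuclideanSpace ℝ (Fin (n + 1))) := {v | ‖v‖ = 1 ∧
      (∀ g ∈ γ '' Icc 0 1, 0 ≤ ⟪v, g⟫) ∧ ∃ g ∈ γ '' Icc 0 1, ⟪v, g⟫ = 0}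
  have hT1 : μH[n] T1 = 0 := by
    refine crofton_null n _ ?_
    rintro _ ⟨t, ht, rfl⟩
    exact hγ0 t ht
  let T2 : Set (EuclideanSpace ℝ (Fin (n + 1))) := {v | ‖v‖ = 1 ∧
      (∀ g ∈ (fun t => -γ t) '' Icc 0 1, 0 ≤ ⟪v, g⟫) ∧ ∃ g ∈ (fun t => -γ t) '' Icc 0 1, ⟪v, g⟫ = 0}
  have hT2 : μH[n] T2 = 0 := by
    refine crofton_null n _ ?_
    rintro _ ⟨t, ht, rfl⟩
    exact neg_ne_zero.2 (hγ0 t ht)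
  let Z : Set (EuclideanSpace ℝ (Fin (n + 1))) := ⋃ k : ℕ, ⋃ i : ℕ, {v | ‖v‖ = 1 ∧
      (∀ g ∈ ({γ (croftonU k i)} : Set (EuclideanSpace ℝ (Fin (n + 1)))), 0 ≤ ⟪v, g⟫) ∧
      ∃ g ∈ ({γ (croftonU k i)} : Set (EuclideanSpace ℝ (Fin (n + 1)))), ⟪v, g⟫ = 0}
  have hZ : μH[n] Z = 0 := by
    refine measure_iUnion_null fun k => measure_iUnion_null fun i => crofton_null n _ ?_
    rintro _ rfl
    exact hγ0 _ (crofton_U_mem k i)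
  let B : ℕ → Set (EuclideanSpace ℝ (Fin (n + 1))) := fun k =>
    ⋃ i ∈ Finset.range (k + 1), croftonW n (γ (croftonU k i)) (γ (croftonU k (i + 1)))
  let D : ℕ → Set (EuclideanSpace ℝ (Fin (n + 1))) := fun K => ⋂ k, ⋂ (_ : K ≤ k), B k
  have hDmono : Monotone D := by
    intro K K' hKK v hv
    simp only [D, mem_iInter] at hv ⊢
    exact fun k hk => hv k (hKK.trans hk)
  have hsub : ({v : EuclideanSpace ℝ (Fin (n + 1)) | ∃ t ∈ Set.Icc (0 : ℝ) 1, ⟪v, γ t⟫ = 0} ∩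
      Metric.sphere (0 : EuclideanSpace ℝ (Fin (n + 1))) 1) ⊆ (⋃ K, D K) ∪ (T1 ∪ (T2 ∪ Z)) := by
    rintro v ⟨⟨r, hr, hvr⟩, hv⟩
    have hv1 : ‖v‖ = 1 := by simpa using hv
    by_cases hvZ : v ∈ Z
    · exact Or.inr (Or.inr (Or.inr hvZ))
    by_cases hp : ∀ t ∈ Icc (0 : ℝ) 1, 0 ≤ ⟪v, γ t⟫
    · refine Or.inr (Or.inl ⟨hv1, ?_, γ r, ⟨r, hr, rfl⟩, hvr⟩)
      rintro _ ⟨t, ht, rfl⟩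
      exact hp t ht
    by_cases hm : ∀ t ∈ Icc (0 : ℝ) 1, ⟪v, γ t⟫ ≤ 0
    · refine Or.inr (Or.inr (Or.inl ⟨hv1, ?_, -γ r, ⟨r, hr, rfl⟩, by simp [hvr]⟩))
      rintro _ ⟨t, ht, rfl⟩
      simpa using hm t ht
    push Not at hp hm
    obtain ⟨s, hs, hfs⟩ := hp
    obtain ⟨t, ht, hft⟩ := hm
    left
    have hev := crofton_sign (fun t => ⟪v, γ t⟫) (by fun_prop) ?_ s t hs ht hfs hft
    · obtain ⟨K, hK⟩ := eventually_atTop.1 hev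
      refine mem_iUnion.2 ⟨K, ?_⟩
      simp only [D, mem_iInter]
      intro k hk
      obtain ⟨i, hi, h⟩ := hK k hk
      exact mem_iUnion₂.2 ⟨i, hi, hv1, h⟩
    · intro k i h0
      refine hvZ (mem_iUnion.2 ⟨k, mem_iUnion.2 ⟨i, hv1, ?_, _, rfl, h0⟩⟩)
      rintro _ rfl
      exact h0.ge
  set M := μH[n] (Metric.sphere (0 : EuclideanSpace ℝ (Fin (n + 1))) 1) with hM
  have hB : ∀ᶠ k in atTop, μH[n] (B k) ≤ ENNReal.ofReal c * eVariationOn γ (Set.Icc 0 1) * M := by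
    obtain ⟨δ, hδ, hsmall⟩ := crofton_small n c hc
    have huc := isCompact_Icc.uniformContinuousOn_of_continuous hγ
    obtain ⟨ε, hε, hu⟩ := Metric.uniformContinuousOn_iff.1 huc δ hδ
    filter_upwards [crofton_U_small ε hε] with k hk
    calc μH[n] (B k) ≤ ∑ i ∈ Finset.range (k + 1),
          μH[n] (croftonW n (γ (croftonU k i)) (γ (croftonU k (i + 1)))) :=
          measure_biUnion_finset_le _ _
      _ ≤ ∑ i ∈ Finset.range (k + 1),
          ENNReal.ofReal c * edist (γ (croftonU k (i + 1))) (γ (croftonU k i)) * M := by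
        refine Finset.sum_le_sum fun i _ => ?_
        rw [edist_comm]
        refine hsmall _ _ (hsph _ (crofton_U_mem _ _)) (hsph _ (crofton_U_mem _ _)) ?_
        rw [dist_comm]
        exact hu _ (crofton_U_mem _ _) _ (crofton_U_mem _ _) ((crofton_U_dist k i).trans_lt hk)
      _ = ENNReal.ofReal c * (∑ i ∈ Finset.range (k + 1),
          edist (γ (croftonU k (i + 1))) (γ (croftonU k i))) * M := by
        rw [Finset.mul_sum, Finset.sum_mul]
      _ ≤ _ := by
        gcongr
        exact eVariationOn.sum_le (crofton_U_mono k) (crofton_U_mem k)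
  have hD : μH[n] (⋃ K, D K) ≤ ENNReal.ofReal c * eVariationOn γ (Set.Icc 0 1) * M := by
    rw [hDmono.measure_iUnion]
    refine iSup_le fun K => ?_
    obtain ⟨k, hk, hKk⟩ := (hB.and (eventually_ge_atTop K)).exists
    refine (measure_mono ?_).trans hk
    exact iInter₂_subset k hKk
  refine (measure_mono hsub).trans ((measure_union_le _ _).trans ?_)
  rw [measure_union_null hT1 (measure_union_null hT2 hZ), add_zero]
  exact hD

end CroftonAux3

/-- **Crofton-type probability bound**: for a continuous path `γ` on the unit sphere
`S^n ⊂ ℝ^{n+1}` of length `L`, the measure — with respect to the uniform probability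
measure on `S^n` (the `n`-dimensional Hausdorff measure restricted to the sphere and
normalized) — of the set of poles `v` whose equator meets `γ` is at most `L / π`. -/
theorem crofton_probability_bound
    (n : ℕ) (hn : 1 ≤ n)
    (γ : ℝ → EuclideanSpace ℝ (Fin (n + 1)))
    (hγ : ContinuousOn γ (Set.Icc 0 1))
    (hsph : ∀ t ∈ Set.Icc (0 : ℝ) 1, ‖γ t‖ = 1)
    (L : ℝ)
    (hlen : eVariationOn γ (Set.Icc 0 1) = ENNReal.ofReal L) :
    (μH[n]).restrict (Metric.sphere (0 : EuclideanSpace ℝ (Fin (n + 1))) 1)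
        {v : EuclideanSpace ℝ (Fin (n + 1)) | ∃ t ∈ Set.Icc (0 : ℝ) 1, ⟪v, γ t⟫ = 0} /
      μH[n] (Metric.sphere (0 : EuclideanSpace ℝ (Fin (n + 1))) 1) ≤
      ENNReal.ofReal (L / Real.pi) := by
  have h : ∀ c : ℝ, 1 / Real.pi < c →
      (μH[n]).restrict (Metric.sphere (0 : EuclideanSpace ℝ (Fin (n + 1))) 1)
        {v : EuclideanSpace ℝ (Fin (n + 1)) | ∃ t ∈ Set.Icc (0 : ℝ) 1, ⟪v, γ t⟫ = 0} /
      μH[n] (Metric.sphere (0 : EuclideanSpace ℝ (Fin (n + 1))) 1) ≤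
      ENNReal.ofReal c * ENNReal.ofReal L := by
    intro c hc
    rw [MeasureTheory.Measure.restrict_apply' Metric.isClosed_sphere.measurableSet]
    refine ENNReal.div_le_of_le_mul ?_
    rw [← hlen]
    exact crofton_bound n γ hγ hsph c hc
  have hlim : Filter.Tendsto (fun c : ℝ => ENNReal.ofReal c * ENNReal.ofReal L)
      (nhdsWithin (1 / Real.pi) (Set.Ioi (1 / Real.pi)))
      (nhds (ENNReal.ofReal (1 / Real.pi) * ENNReal.ofReal L)) := by
    refine ENNReal.Tendsto.mul_const ?_ (Or.inr ENNReal.ofReal_ne_top)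
    exact (ENNReal.continuous_ofReal.tendsto _).mono_left nhdsWithin_le_nhds
  have hfin := ge_of_tendsto hlim (Filter.eventually_of_mem self_mem_nhdsWithin h)
  rw [← ENNReal.ofReal_mul (by positivity)] at hfin
  rwa [show 1 / Real.pi * L = L / Real.pi by ring] at hfin
end

section
/- Gromov-type waist bound in codimension one for the sphere: let n ≥ 1 and let f : S^n → ℝ^{n−1} be a continuous map. Then there exist a point y ∈ ℝ^{n−1} and a connected component W of the fiber f⁻¹(y) whose one-dimensional Hausdorff measure is at least π. In particular, the waist γ(S^n, ℝ^{n−1}) is at least π. -/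
open scoped MeasureTheory

namespace WaistAux

open Set Metric MeasureTheory Filter Topology

variable {E : Type*} [NormedAddCommGroup E] [InnerProductSpace ℝ E] [FiniteDimensional ℝ E]

/-- `det (1 + t A)` is a polynomial in `t` of degree at most the dimension. -/
lemma exists_det_poly (A : E →L[ℝ] E) :
    ∃ p : Polynomial ℝ, p.natDegree ≤ Module.finrank ℝ E ∧
      ∀ t : ℝ, p.eval t = (ContinuousLinearMap.id ℝ E + t • A).det := by
  classical
  let b := Module.finBasis ℝ E
  let M := LinearMap.toMatrix b b (A : E →ₗ[ℝ] E)
  refine ⟨((Polynomial.X : Polynomial ℝ) • M.map Polynomial.C +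
    (1 : Matrix (Fin (Module.finrank ℝ E)) (Fin (Module.finrank ℝ E)) ℝ).map Polynomial.C).det,
    ?_, ?_⟩
  · simpa using Polynomial.natDegree_det_X_add_C_le M 1
  · intro t
    have h1 : (ContinuousLinearMap.id ℝ E + t • A).det
        = (LinearMap.toMatrix b b ((ContinuousLinearMap.id ℝ E + t • A : E →L[ℝ] E) :
            E →ₗ[ℝ] E)).det := by
      rw [LinearMap.det_toMatrix]
    rw [h1, ← Polynomial.coe_evalRingHom, RingHom.map_det]
    congr 1
    have h2 : ((ContinuousLinearMap.id ℝ E + t • A : E →L[ℝ] E) : E →ₗ[ℝ] E)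
      = LinearMap.id + t • (A : E →ₗ[ℝ] E) := rfl
    have h3 : LinearMap.toMatrix b b (LinearMap.id + t • (A : E →ₗ[ℝ] E)) = 1 + t • M := by
      rw [map_add, map_smul, LinearMap.toMatrix_id]
    rw [h2, h3]
    ext i j
    simp [M, Matrix.one_apply]
    by_cases hij : i = j <;> simp [hij] <;> ring

/-- A `C^1` field of fixed norm `2`, equal to the identity on the sphere of radius `2`,
does not exist. -/
lemma no_retraction (R : E → E) (hR : ContDiff ℝ 1 R)
    (hnorm : ∀ x, ‖R x‖ = 2) (hid : ∀ x, ‖x‖ = 2 → R x = x) : False := by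
  classical
  let _ : MeasurableSpace E := borel E
  have : BorelSpace E := ⟨rfl⟩
  let μ : Measure E := Measure.addHaar
  let B : Set E := ball 0 2
  let g : E → E := fun x => R x - x
  have hg : ContDiff ℝ 1 g := hR.sub contDiff_id
  obtain ⟨K, hK⟩ := (hg.contDiffOn (s := closedBall (0 : E) 2)).exists_lipschitzOnWith
    one_ne_zero (convex_closedBall _ _) (isCompact_closedBall _ _)
  let G : E → E := fun x => if ‖x‖ ≤ 2 then g x else 0
  have hG1 : ∀ x, ‖x‖ ≤ 2 → G x = g x := fun x hx => if_pos hx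
  have hG2 : ∀ x, 2 ≤ ‖x‖ → G x = 0 := by
    intro x hx
    rcases hx.eq_or_lt with h | h
    · rw [hG1 x h.ge]; simp [g, hid x h.symm]
    · exact if_neg (not_le.2 h)
  have key : ∀ x y, ‖x‖ ≤ 2 → 2 ≤ ‖y‖ → dist (G x) (G y) ≤ K * dist x y := by
    intro x y hx hy
    have hc : ContinuousOn (fun z : E => ‖z‖) (segment ℝ x y) := continuous_norm.continuousOn
    obtain ⟨z, hz, hz2⟩ := (convex_segment x y).isPreconnected.intermediate_value
      (left_mem_segment ℝ x y) (right_mem_segment ℝ x y) hc ⟨hx, hy⟩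
    have hz2 : ‖z‖ = 2 := hz2
    have hd := dist_add_dist_of_mem_segment hz
    rw [hG2 y hy, ← hG2 z hz2.ge, hG1 x hx, hG1 z hz2.le]
    calc dist (g x) (g z) ≤ K * dist x z :=
          hK.dist_le_mul x (by simpa using hx) z (by simp [hz2])
      _ ≤ K * dist x y := by
          gcongr
          linarith [dist_nonneg (x := z) (y := y)]
  have hLip : LipschitzWith K G := by
    apply LipschitzWith.of_dist_le_mul
    intro x y
    rcases le_total ‖x‖ 2 with hx | hx <;> rcases le_total ‖y‖ 2 with hy | hy
    · rw [hG1 x hx, hG1 y hy]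
      exact hK.dist_le_mul x (by simpa using hx) y (by simpa using hy)
    · exact key x y hx hy
    · rw [dist_comm, dist_comm x]; exact key y x hy hx
    · rw [hG2 x hx, hG2 y hy]; simp; positivity
  -- positivity of the determinant
  have hdg : Continuous (fderiv ℝ g) := hg.continuous_fderiv one_ne_zero
  obtain ⟨C, hC⟩ := (isCompact_closedBall (0 : E) 2).exists_bound_of_continuousOn
    hdg.continuousOn
  have hdet : ∀ᶠ A : E →L[ℝ] E in 𝓝 (ContinuousLinearMap.id ℝ E), 0 < A.det := by
    have := (ContinuousLinearMap.continuous_det (𝕜 := ℝ) (E := E)).tendsto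
      (ContinuousLinearMap.id ℝ E)
    apply this.eventually (lt_mem_nhds _)
    simp [ContinuousLinearMap.det]
  obtain ⟨η, hη, hdet⟩ := Metric.eventually_nhds_iff.1 hdet
  obtain ⟨τ, hτ, hτK, hτC⟩ : ∃ τ : ℝ, 0 < τ ∧ τ * K < 1 ∧ τ * (|C|) < η := by
    have h1 : ∀ᶠ τ : ℝ in 𝓝[>] 0, τ * K < 1 := by
      have : Tendsto (fun τ : ℝ => τ * K) (𝓝[>] 0) (𝓝 (0 * K)) :=
        (Continuous.tendsto (by fun_prop) 0).mono_left nhdsWithin_le_nhds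
      exact this.eventually (gt_mem_nhds (by simp))
    have h2 : ∀ᶠ τ : ℝ in 𝓝[>] 0, τ * |C| < η := by
      have : Tendsto (fun τ : ℝ => τ * |C|) (𝓝[>] 0) (𝓝 (0 * |C|)) :=
        (Continuous.tendsto (by fun_prop) 0).mono_left nhdsWithin_le_nhds
      exact this.eventually (gt_mem_nhds (by simpa using hη))
    obtain ⟨τ, ⟨h1, h2⟩, h3⟩ := ((h1.and h2).and self_mem_nhdsWithin).exists
    exact ⟨τ, h3, h1, h2⟩
  -- integrals
  let D : ℝ → E → ℝ := fun t x => (ContinuousLinearMap.id ℝ E + t • fderiv ℝ g x).det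
  have hDc : ∀ t, Continuous (D t) := fun t =>
    ContinuousLinearMap.continuous_det.comp (continuous_const.add (hdg.const_smul t))
  have hDi : ∀ t, IntegrableOn (D t) B μ := fun t =>
    ((hDc t).continuousOn.integrableOn_compact (isCompact_closedBall (0 : E) 2)).mono_set
      ball_subset_closedBall
  have hsmall : ∀ t, 0 < t → t ≤ τ → ∫ x in B, D t x ∂μ = μ.real B := by
    intro t ht htτ
    let φ : E → E := fun x => x + t • G x
    have htK : t * K < 1 := lt_of_le_of_lt (by gcongr) hτK
    have hLt : ∀ y, ContractingWith ⟨t * K, by positivity⟩ (fun x => y - t • G x) := by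
      intro y
      refine ⟨by exact_mod_cast htK, LipschitzWith.of_dist_le_mul ?_⟩
      intro a b
      have := hLip.dist_le_mul a b
      rw [dist_sub_left, dist_smul₀, Real.norm_of_nonneg ht.le]
      show _ ≤ (t * K) * dist a b
      rw [mul_assoc]
      gcongr
    have hinj : Function.Injective φ := by
      intro a b hab
      have h1 : a - b = t • G b - t • G a := by
        have : a + t • G a = b + t • G b := hab
        rw [sub_eq_sub_iff_add_eq_add]; rw [this]; abel
      have h2 : dist a b ≤ t * K * dist a b := by
        have := hLip.dist_le_mul b a
        calc dist a b = ‖t • (G b - G a)‖ := by rw [dist_eq_norm, h1, smul_sub]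
          _ = t * dist (G b) (G a) := by
            rw [norm_smul, Real.norm_of_nonneg ht.le, dist_eq_norm]
          _ ≤ t * (K * dist b a) := by gcongr
          _ = _ := by rw [dist_comm b a]; ring
      by_contra hne
      have := dist_pos.2 hne
      nlinarith
    have himg : φ '' B = B := by
      have hout : ∀ x, 2 ≤ ‖x‖ → φ x = x := fun x hx => by simp [φ, hG2 x hx]
      apply Subset.antisymm
      · rintro _ ⟨x, hx, rfl⟩
        by_contra hn
        have h2 : 2 ≤ ‖φ x‖ := by simpa [B] using hn
        have := hinj (hout _ h2)
        rw [this] at h2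
        have : ‖x‖ < 2 := by simpa [B] using hx
        linarith
      · intro y hy
        have hfix := (hLt y).fixedPoint_isFixedPt
        set x := ContractingWith.fixedPoint _ (hLt y)
        have hx : y - t • G x = x := hfix
        have hxy : φ x = y := by
          show x + t • G x = y
          nth_rewrite 1 [← hx]; abel
        refine ⟨x, ?_, hxy⟩
        by_contra hn
        have h2 : 2 ≤ ‖x‖ := by simpa [B] using hn
        rw [hout x h2] at hxy
        exact hn (hxy ▸ hy)
    have hder : ∀ x ∈ B, HasFDerivWithinAt φ
        (ContinuousLinearMap.id ℝ E + t • fderiv ℝ g x) B x := by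
      intro x hx
      apply HasFDerivAt.hasFDerivWithinAt
      have h1 : HasFDerivAt (fun x => x + t • g x)
          (ContinuousLinearMap.id ℝ E + t • fderiv ℝ g x) x :=
        (hasFDerivAt_id x).add
          (((hg.differentiable one_ne_zero) x).hasFDerivAt.const_smul t)
      refine h1.congr_of_eventuallyEq ?_
      filter_upwards [isOpen_ball.mem_nhds hx] with z hz
      have : ‖z‖ ≤ 2 := (by simpa [B] using hz : ‖z‖ < 2).le
      simp [φ, hG1 z this]
    have hpos : ∀ x ∈ B, 0 < D t x := by
      intro x hx
      apply hdet
      rw [dist_eq_norm, add_sub_cancel_left, norm_smul, Real.norm_of_nonneg ht.le]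
      calc t * ‖fderiv ℝ g x‖ ≤ τ * |C| := by
            gcongr
            exact (hC x (ball_subset_closedBall hx)).trans (le_abs_self C)
        _ < η := hτC
    have hcv := lintegral_abs_det_fderiv_eq_addHaar_image μ measurableSet_ball hder hinj.injOn
    rw [himg] at hcv
    rw [integral_eq_lintegral_of_nonneg_ae
      ((ae_restrict_iff' measurableSet_ball).2 (ae_of_all _ fun x hx => (hpos x hx).le))
      (hDc t).aestronglyMeasurable, Measure.real, ← hcv]
    congr 1
    refine setLIntegral_congr_fun measurableSet_ball fun x hx => ?_
    show _ = ENNReal.ofReal |D t x|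
    rw [abs_of_pos (hpos x hx)]
  -- interpolation
  let N := Module.finrank ℝ E
  let v : ℕ → ℝ := fun i => τ / (i + 1)
  have hv : InjOn v (Finset.range (N + 1) : Set ℕ) := by
    intro i _ j _ hij
    have : τ / ((i : ℝ) + 1) = τ / ((j : ℝ) + 1) := hij
    field_simp at this
    have : (i : ℝ) = j := by linarith
    exact_mod_cast this
  let c : ℕ → ℝ := fun i => (Lagrange.basis (Finset.range (N + 1)) v i).eval 1
  have hc1 : ∑ i ∈ Finset.range (N + 1), c i = 1 := by
    have := Lagrange.sum_basis hv ⟨0, by simp⟩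
    have := congrArg (Polynomial.eval (1 : ℝ)) this
    rw [Polynomial.eval_finsetSum] at this
    simpa [c] using this
  have hD1 : ∀ x, D 1 x = ∑ i ∈ Finset.range (N + 1), c i * D (v i) x := by
    intro x
    obtain ⟨p, hp, hpe⟩ := exists_det_poly (fderiv ℝ g x)
    have h1 : p.degree < (Finset.range (N + 1)).card := by
      rw [Finset.card_range]
      exact lt_of_le_of_lt Polynomial.degree_le_natDegree (by exact_mod_cast Nat.lt_succ_of_le hp)
    have h2 := Lagrange.eq_interpolate hv h1
    rw [Lagrange.interpolate_apply] at h2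
    have h3 := congrArg (Polynomial.eval (1 : ℝ)) h2
    rw [Polynomial.eval_finsetSum, hpe 1] at h3
    show D 1 x = _
    refine (h3 : D 1 x = _).trans (Finset.sum_congr rfl fun i _ => ?_)
    rw [Polynomial.eval_mul, Polynomial.eval_C, hpe, mul_comm]
  have hvol : ∫ x in B, D 1 x ∂μ = μ.real B := by
    simp_rw [hD1]
    rw [integral_finsetSum _ (fun i _ => (hDi (v i)).const_mul (c i))]
    simp_rw [integral_const_mul]
    have : ∀ i ∈ Finset.range (N + 1), c i * ∫ x in B, D (v i) x ∂μ = c i * μ.real B := by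
      intro i _
      rw [hsmall (v i) (by positivity)
        (div_le_self hτ.le (by have : (0 : ℝ) ≤ i := by positivity
                               linarith))]
    rw [Finset.sum_congr rfl this, ← Finset.sum_mul, hc1, one_mul]
  -- the determinant vanishes at time one
  have hzero : ∀ x, D 1 x = 0 := by
    intro x
    have hRd : HasFDerivAt R (fderiv ℝ R x) x :=
      ((hR.differentiable one_ne_zero) x).hasFDerivAt
    have hgd : ContinuousLinearMap.id ℝ E + (1 : ℝ) • fderiv ℝ g x = fderiv ℝ R x := by
      have : HasFDerivAt g (fderiv ℝ R x - ContinuousLinearMap.id ℝ E) x :=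
        hRd.sub (hasFDerivAt_id x)
      rw [this.fderiv, one_smul]; abel
    show (ContinuousLinearMap.id ℝ E + (1 : ℝ) • fderiv ℝ g x).det = 0
    rw [hgd]
    by_contra hne
    have hu : IsUnit ((fderiv ℝ R x : E →L[ℝ] E) : E →ₗ[ℝ] E) := by
      rw [LinearMap.isUnit_iff_isUnit_det]
      exact isUnit_iff_ne_zero.2 hne
    have hsurj := ((Module.End.isUnit_iff _).1 hu).2
    obtain ⟨w, hw⟩ := hsurj (R x)
    have hw : fderiv ℝ R x w = R x := hw
    have h1 := hRd.inner ℝ hRd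
    have h2 : (fun t => inner ℝ (R t) (R t)) = fun _ => (4 : ℝ) := by
      funext z; rw [real_inner_self_eq_norm_sq, hnorm]; norm_num
    rw [h2] at h1
    have h3 := h1.unique (hasFDerivAt_const (4 : ℝ) x)
    have h4 := congrArg (fun L : E →L[ℝ] ℝ => L w) h3
    simp [hw, fderivInnerCLM_apply, hnorm] at h4
  have : μ.real B = 0 := by rw [← hvol]; simp [hzero]
  have hBpos : 0 < μ B := isOpen_ball.measure_pos μ ⟨0, by simp⟩
  have hBfin : μ B ≠ ⊤ := measure_ball_lt_top.ne
  exact (ENNReal.toReal_pos hBpos.ne' hBfin).ne' this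

/-- A continuous map equal to the identity off the unit ball has a zero. -/
lemma exists_zero (H : E → E) (hH : Continuous H)
    (hid : ∀ x, 1 ≤ ‖x‖ → H x = x) : ∃ x, H x = 0 := by
  by_contra! hne
  have hS : IsClosed {x : E | 2 ≤ ‖x‖} := isClosed_le continuous_const continuous_norm
  have hU : IsOpen {x : E | 1 < ‖x‖} := isOpen_lt continuous_const continuous_norm
  obtain ⟨g, hg, hgH, hgS, -⟩ := hH.exists_contDiff_approx_and_eqOn (ε := fun x => ‖H x‖) 1
    hH.norm (fun x => norm_pos_iff.2 (hne x)) hS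
    (hU.mem_nhdsSet.2 (fun x (hx : 2 ≤ ‖x‖) => show 1 < ‖x‖ by linarith))
    (contDiffOn_id.congr fun x (hx : 1 < ‖x‖) => hid x hx.le)
  have hg0 : ∀ x, g x ≠ 0 := by
    intro x h0
    have := hgH x
    rw [h0, dist_zero_left] at this
    exact lt_irrefl _ this
  have hg' : ContDiff ℝ 1 g := by exact_mod_cast hg
  refine no_retraction (fun x => (2 * ‖g x‖⁻¹) • g x) ?_ ?_ ?_
  · exact (contDiff_const.mul ((hg'.norm ℝ hg0).inv fun x => norm_ne_zero_iff.2 (hg0 x))).smul hg'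
  · intro x
    have := norm_ne_zero_iff.2 (hg0 x)
    rw [norm_smul]; simp [this]
  · intro x hx
    have h1 : g x = x := by
      rw [hgS (show (2 : ℝ) ≤ ‖x‖ from hx.ge), hid x (by linarith)]
    show (2 * ‖g x‖⁻¹) • g x = x
    rw [h1, hx]; norm_num


lemma ray_hit (g : E → E) (hg : ContinuousOn g (sphere 0 1))
    (hpos : ∀ x, ‖x‖ = 1 → 0 < inner ℝ (g x) x) (v : E) (hv : v ≠ 0) :
    ∃ x, ‖x‖ = 1 ∧ ∃ s : ℝ, v = s • g x := by
  let G : E → E := fun z => ‖z‖ • g (‖z‖⁻¹ • z)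
  have hunit : ∀ z : E, z ≠ 0 → ‖‖z‖⁻¹ • z‖ = 1 := fun z hz => by
    have := norm_ne_zero_iff.2 hz
    rw [norm_smul]; simp [this]
  have hG0 : G 0 = 0 := by simp [G]
  have hGc : Continuous G := by
    rw [continuous_iff_continuousAt]
    intro z
    by_cases hz : z = 0
    · subst hz
      obtain ⟨M, hM⟩ := (isCompact_sphere (0 : E) 1).exists_bound_of_continuousOn hg
      have hb : ∀ z, ‖G z‖ ≤ ‖z‖ * |M| := by
        intro z
        by_cases hz : z = 0
        · subst hz; simp [hG0]
        · simp only [G]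
          rw [norm_smul, norm_norm]
          gcongr
          exact (hM _ (by simpa using hunit z hz)).trans (le_abs_self M)
      unfold ContinuousAt
      rw [hG0]
      refine squeeze_zero_norm hb ?_
      have : Tendsto (fun z : E => ‖z‖ * |M|) (𝓝 0) (𝓝 (‖(0 : E)‖ * |M|)) :=
        Continuous.tendsto (by fun_prop) 0
      simpa using this
    · have h1 : ContinuousOn (fun z : E => ‖z‖⁻¹ • z) {0}ᶜ :=
        (continuous_norm.continuousOn.inv₀ fun z hz => norm_ne_zero_iff.2 hz).smul
          continuousOn_id
      have h2 : ContinuousOn G {0}ᶜ :=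
        continuous_norm.continuousOn.smul
          (hg.comp h1 fun z hz => by simpa using hunit z hz)
      exact h2.continuousAt (isOpen_compl_singleton.mem_nhds hz)
  have hGpos : ∀ z, z ≠ 0 → 0 < inner ℝ (G z) z := by
    intro z hz
    have h1 := hpos _ (hunit z hz)
    have h2 := norm_pos_iff.2 hz
    have h3 : inner ℝ (G z) z = ‖z‖ ^ 2 * inner ℝ (g (‖z‖⁻¹ • z)) (‖z‖⁻¹ • z) := by
      simp only [G]
      rw [real_inner_smul_left, real_inner_smul_right]
      field_simp
    rw [h3]; positivity
  let a : E → ℝ := fun z => max 0 (min 1 (2 - 2 * ‖z‖))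
  let b : E → ℝ := fun z => max 0 (min 1 (2 * ‖z‖ - 1))
  let c : E → ℝ := fun z => max 0 (1 - 2 * ‖z‖)
  obtain ⟨z, hz⟩ := exists_zero (fun z => a z • G z + b z • z - c z • v)
    (by simp only [a, b, c]; fun_prop) (by
      intro z hz
      have ha : a z = 0 := max_eq_left (min_le_of_right_le (by linarith))
      have hb : b z = 1 := by
        simp only [b]
        rw [min_eq_left (by linarith), max_eq_right zero_le_one]
      have hc : c z = 0 := max_eq_left (by linarith)
      simp [ha, hb, hc])
  have hz : a z • G z + b z • z - c z • v = 0 := hz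
  by_cases h : ‖z‖ < 1 / 2
  · have ha : a z = 1 := by
      simp only [a]
      rw [min_eq_left (by linarith), max_eq_right zero_le_one]
    have hb : b z = 0 := max_eq_left (min_le_of_right_le (by linarith))
    have hc : c z = 1 - 2 * ‖z‖ := max_eq_right (by linarith)
    have hcp : 0 < 1 - 2 * ‖z‖ := by linarith
    rw [ha, hb, hc, one_smul, zero_smul, add_zero, sub_eq_zero] at hz
    have hv' : v = (1 - 2 * ‖z‖)⁻¹ • G z := by
      rw [hz, smul_smul, inv_mul_cancel₀ hcp.ne', one_smul]
    have hz0 : z ≠ 0 := by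
      rintro rfl
      rw [hG0, smul_zero] at hv'
      exact hv hv'
    refine ⟨_, hunit z hz0, (1 - 2 * ‖z‖)⁻¹ * ‖z‖, ?_⟩
    rw [hv', mul_smul]
  · exfalso
    have h : 1 / 2 ≤ ‖z‖ := not_lt.1 h
    have hz0 : z ≠ 0 := by rintro rfl; simp at h; linarith
    have hc : c z = 0 := max_eq_left (by linarith)
    rw [hc, zero_smul, sub_zero] at hz
    have h1 := congrArg (fun w => inner ℝ w z) hz
    simp only [inner_add_left, real_inner_smul_left, inner_zero_left,
      real_inner_self_eq_norm_sq] at h1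
    have h2 := hGpos z hz0
    have h3 : 0 < ‖z‖ ^ 2 := by positivity
    have ha0 : 0 ≤ a z := le_max_left _ _
    have hb0 : 0 ≤ b z := le_max_left _ _
    have h4 : 0 ≤ a z * inner ℝ (G z) z := by positivity
    have h5 : 0 ≤ b z * ‖z‖ ^ 2 := by positivity
    have h6 : a z = 0 := by
      have : a z * inner ℝ (G z) z = 0 := by linarith
      exact (mul_eq_zero.1 this).resolve_right h2.ne'
    have h7 : b z = 0 := by
      have : b z * ‖z‖ ^ 2 = 0 := by linarith
      exact (mul_eq_zero.1 this).resolve_right h3.ne'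
    rcases le_total ‖z‖ (3/4) with h8 | h8
    · have : 1 / 2 ≤ a z := le_max_of_le_right (le_min (by norm_num) (by linarith))
      linarith
    · have : 1 / 2 ≤ b z := le_max_of_le_right (le_min (by norm_num) (by linarith))
      linarith

lemma local_split {X Y : Type*} [MetricSpace X] [MetricSpace Y] (S : Set X) (hS : IsCompact S)
    (f : X → Y) (hf : ContinuousOn f S) (x : X) (hx : x ∈ S) (V : Set X) (hV : IsOpen V)
    (hcomp : connectedComponentIn {z | z ∈ S ∧ f z = f x} x ⊆ V) :
    ∃ O₁ O₂ : Set X, IsOpen O₁ ∧ IsOpen O₂ ∧ Disjoint O₁ O₂ ∧ x ∈ O₁ ∧ O₁ ⊆ V ∧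
      ∃ r > 0, ∀ z ∈ S, dist (f z) (f x) < r → z ∈ O₁ ∪ O₂ := by
  let F : Set X := {z | z ∈ S ∧ f z = f x}
  have hFc : IsCompact F := by
    have : F = S ∩ f ⁻¹' {f x} := rfl
    rw [this]
    exact hS.of_isClosed_subset
      (hf.preimage_isClosed_of_isClosed hS.isClosed isClosed_singleton) inter_subset_left
  have : CompactSpace F := isCompact_iff_compactSpace.1 hFc
  have hxF : x ∈ F := ⟨hx, rfl⟩
  let x' : F := ⟨x, hxF⟩
  rw [connectedComponentIn_eq_image hxF, image_subset_iff] at hcomp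
  have hcomp : connectedComponent x' ⊆ Subtype.val ⁻¹' V := hcomp
  rw [connectedComponent_eq_iInter_isClopen] at hcomp
  obtain ⟨C, hC, hxC, hCV⟩ : ∃ C : Set F, IsClopen C ∧ x' ∈ C ∧ C ⊆ Subtype.val ⁻¹' V := by
    have hne : Nonempty { s : Set F // IsClopen s ∧ x' ∈ s } := ⟨⟨univ, isClopen_univ, mem_univ _⟩⟩
    obtain ⟨⟨C, hC1, hC2⟩, hC3⟩ := exists_subset_nhds_of_compactSpace
      (V := fun s : { s : Set F // IsClopen s ∧ x' ∈ s } => (s : Set F))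
      (by
        intro a b
        exact ⟨⟨a.1 ∩ b.1, a.2.1.inter b.2.1, a.2.2, b.2.2⟩, inter_subset_left,
          inter_subset_right⟩)
      (fun s => s.2.1.1)
      (U := Subtype.val ⁻¹' V)
      (fun z hz => (hV.preimage continuous_subtype_val).mem_nhds (hcomp hz))
    exact ⟨C, hC1, hC2, hC3⟩
  have hK1 : IsCompact (Subtype.val '' C) := hC.1.isCompact.image continuous_subtype_val
  have hK2 : IsCompact (Subtype.val '' Cᶜ) :=
    hC.compl.1.isCompact.image continuous_subtype_val
  have hd : Disjoint (Subtype.val '' C) (Subtype.val '' Cᶜ) :=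
    (disjoint_image_iff Subtype.val_injective).2 disjoint_compl_right
  obtain ⟨P, Q, hP, hQ, hCP, hCQ, hPQ⟩ := SeparatedNhds.of_isCompact_isCompact hK1 hK2 hd
  refine ⟨P ∩ V, Q, hP.inter hV, hQ, hPQ.mono_left inter_subset_left, ⟨hCP ⟨x', hxC, rfl⟩,
    hCV hxC⟩, inter_subset_right, ?_⟩
  have hTc : IsCompact (S \ (P ∩ V ∪ Q)) := hS.diff ((hP.inter hV).union hQ)
  have hTi : IsClosed (f '' (S \ (P ∩ V ∪ Q))) :=
    (hTc.image_of_continuousOn (hf.mono sdiff_subset)).isClosed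
  have hfx : f x ∈ (f '' (S \ (P ∩ V ∪ Q)))ᶜ := by
    rintro ⟨z, ⟨hzS, hz⟩, hzx⟩
    apply hz
    have hzF : z ∈ F := ⟨hzS, hzx⟩
    by_cases h : (⟨z, hzF⟩ : F) ∈ C
    · exact Or.inl ⟨hCP ⟨_, h, rfl⟩, hCV h⟩
    · exact Or.inr (hCQ ⟨_, h, rfl⟩)
  obtain ⟨r, hr, hball⟩ := Metric.isOpen_iff.1 hTi.isOpen_compl _ hfx
  refine ⟨r, hr, fun z hz hzr => ?_⟩
  by_contra hn
  exact hball (mem_ball.2 hzr) ⟨z, ⟨hz, hn⟩, rfl⟩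

lemma topological {Y : Type*} [NormedAddCommGroup Y] [InnerProductSpace ℝ Y]
    [FiniteDimensional ℝ Y] (hdim : Module.finrank ℝ Y + 1 < Module.finrank ℝ E)
    (f : E → Y) (hf : ContinuousOn f (sphere 0 1))
    (hcomp : ∀ x : E, ‖x‖ = 1 → ∃ u : E,
      connectedComponentIn {z | ‖z‖ = 1 ∧ f z = f x} x ⊆ {z | 0 < inner ℝ u z}) : False := by
  classical
  have hmem : ∀ x : E, x ∈ sphere (0 : E) 1 ↔ ‖x‖ = 1 := fun x => by simp
  have hloc : ∀ x : sphere (0 : E) 1, ∃ (u : E) (ψ : Y → ℝ) (O : Set E), ContDiff ℝ 1 ψ ∧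
      (∀ y, 0 ≤ ψ y) ∧ 0 < ψ (f x) ∧ x.1 ∈ O ∧ (∀ z ∈ O, 0 < inner ℝ u z) ∧
      Continuous (fun z : sphere (0 : E) 1 => if z.1 ∈ O then ψ (f z) else 0) := by
    intro x
    obtain ⟨u, hu⟩ := hcomp x ((hmem _).1 x.2)
    obtain ⟨O₁, O₂, hO₁, hO₂, hdisj, hxO, hOV, r, hr, hsplit⟩ :=
      local_split (sphere (0 : E) 1) (isCompact_sphere 0 1) f hf x x.2 {z | 0 < inner ℝ u z}
        (isOpen_lt continuous_const (by fun_prop)) (by simpa only [hmem] using hu)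
    let ψ : ContDiffBump (f x) := ⟨r / 4, r / 2, by positivity, by linarith⟩
    have hfc : Continuous (fun z : sphere (0 : E) 1 => f z) :=
      continuousOn_iff_continuous_domRestrict.1 hf
    refine ⟨u, ψ, O₁, ψ.contDiff, fun y => ψ.nonneg, ψ.pos_of_mem_ball (by simp [ψ, hr]), hxO,
      hOV, ?_⟩
    rw [continuous_iff_continuousAt]
    intro z
    by_cases h1 : z.1 ∈ O₁
    · have : (fun z : sphere (0 : E) 1 => ψ (f z)) =ᶠ[𝓝 z]
          (fun z : sphere (0 : E) 1 => if z.1 ∈ O₁ then ψ (f z) else 0) := by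
        filter_upwards [(hO₁.preimage continuous_subtype_val).mem_nhds h1] with w hw
        exact (if_pos hw).symm
      exact (ψ.continuous.comp hfc).continuousAt.congr this
    · have : (fun z : sphere (0 : E) 1 => (0 : ℝ)) =ᶠ[𝓝 z]
          (fun z : sphere (0 : E) 1 => if z.1 ∈ O₁ then ψ (f z) else 0) := by
        by_cases h2 : z.1 ∈ O₂
        · filter_upwards [(hO₂.preimage continuous_subtype_val).mem_nhds h2] with w hw
          rw [if_neg fun h => hdisj.le_bot ⟨h, hw⟩]
        · have h3 : r ≤ dist (f z) (f x) := by
            by_contra hlt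
            exact (hsplit z z.2 (not_le.1 hlt)).elim h1 h2
          have h4 : ∀ᶠ w : sphere (0 : E) 1 in 𝓝 z, r / 2 < dist (f w) (f x) :=
            ((hfc.dist continuous_const).tendsto z).eventually (lt_mem_nhds (by linarith))
          filter_upwards [h4] with w hw
          rw [ψ.zero_of_le_dist hw.le]; simp
      exact continuousAt_const.congr this
  choose u ψ O hψ hψ0 hψx hxO hOu hcont using hloc
  let h : sphere (0 : E) 1 → sphere (0 : E) 1 → ℝ :=
    fun x z => if z.1 ∈ O x then ψ x (f z) else 0
  have hh0 : ∀ x z, 0 ≤ h x z := by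
    intro x z; simp only [h]; split_ifs; exacts [hψ0 _ _, le_rfl]
  have hhx : ∀ x, 0 < h x x := fun x => by simp only [h]; rw [if_pos (hxO x)]; exact hψx x
  obtain ⟨t, ht⟩ := (isCompact_univ (X := sphere (0 : E) 1)).elim_finite_subcover
    (fun x => {z | 0 < h x z}) (fun x => isOpen_lt continuous_const (hcont x))
    (fun x _ => mem_iUnion.2 ⟨x, hhx x⟩)
  let g' : sphere (0 : E) 1 → E := fun z => ∑ x ∈ t, h x z • u x
  have hg'c : Continuous g' :=
    continuous_finsetSum _ fun x _ => (hcont x).smul continuous_const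
  have hg'pos : ∀ z, 0 < inner ℝ (g' z) z.1 := by
    intro z
    simp only [g']
    rw [sum_inner]
    have hterm : ∀ x, 0 ≤ inner ℝ (h x z • u x) z.1 ∧
        (0 < h x z → 0 < inner ℝ (h x z • u x) z.1) := by
      intro x
      rw [real_inner_smul_left]
      by_cases hz : z.1 ∈ O x
      · have := hOu x _ hz
        exact ⟨mul_nonneg (hh0 _ _) this.le, fun h => mul_pos h this⟩
      · have : h x z = 0 := if_neg hz
        rw [this]; simp
    obtain ⟨x, hx⟩ := mem_iUnion.1 (ht (mem_univ z))
    obtain ⟨hxt, hx⟩ := mem_iUnion.1 hx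
    exact Finset.sum_pos' (fun x _ => (hterm x).1) ⟨x, hxt, (hterm x).2 hx⟩
  let g : E → E := fun z => if hz : z ∈ sphere (0 : E) 1 then g' ⟨z, hz⟩ else 0
  have hg : ContinuousOn g (sphere 0 1) := by
    rw [continuousOn_iff_continuous_domRestrict]
    convert hg'c using 1
    funext z
    simp only [g, domRestrict_apply]
    rw [dif_pos z.2]
  have hgpos : ∀ x, ‖x‖ = 1 → 0 < inner ℝ (g x) x := by
    intro x hx
    have hx' := (hmem x).2 hx
    simp only [g]
    rw [dif_pos hx']
    exact hg'pos ⟨x, hx'⟩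
  let Φ : Finset (sphere (0 : E) 1) → ℝ × Y → E := fun I p => p.1 • ∑ x ∈ I, ψ x p.2 • u x
  have hΦ : ∀ I, dimH (range (Φ I)) ≤ ((Module.finrank ℝ Y + 1 : ℕ) : ENNReal) := by
    intro I
    have : ContDiff ℝ 1 (Φ I) := by
      refine contDiff_fst.smul (ContDiff.sum fun x _ => ?_)
      exact ((hψ x).comp contDiff_snd).smul contDiff_const
    refine this.dimH_range_le.trans ?_
    rw [Module.finrank_prod, Module.finrank_self, add_comm]
  have hbad : dimH (⋃ I ∈ (t.powerset : Set (Finset (sphere (0 : E) 1))), range (Φ I))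
      < (Module.finrank ℝ E : ENNReal) := by
    rw [dimH_bUnion (t.powerset.finite_toSet.countable)]
    refine lt_of_le_of_lt (iSup₂_le fun I _ => hΦ I) ?_
    exact_mod_cast hdim
  obtain ⟨v, hv⟩ := (dense_compl_of_dimH_lt_finrank hbad).nonempty
  have hv' : ∀ I ⊆ t, ∀ p, v ≠ Φ I p := by
    intro I hI p hp
    apply hv
    exact mem_biUnion (Finset.mem_coe.2 (Finset.mem_powerset.2 hI)) ⟨p, hp.symm⟩
  have hv0 : v ≠ 0 := by
    intro h0
    exact hv' ∅ (by simp) (0, 0) (by simp [Φ, h0])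
  obtain ⟨x, hx, s, hs⟩ := ray_hit g hg hgpos v hv0
  have hx' := (hmem x).2 hx
  refine hv' (t.filter fun a => x ∈ O a) (Finset.filter_subset _ _) (s, f x) ?_
  rw [hs]
  simp only [g, Φ, g', h]
  rw [dif_pos hx', Finset.sum_filter]
  congr 1
  refine Finset.sum_congr rfl fun a _ => ?_
  split_ifs <;> simp

open InnerProductGeometry

lemma cos_angle_unit (x y : E) (hx : ‖x‖ = 1) (hy : ‖y‖ = 1) :
    inner ℝ x y = Real.cos (angle x y) := by
  rw [cos_angle, hx, hy]; simp

lemma angle_eq_of_inner (x y : E) (hx : ‖x‖ = 1) (hy : ‖y‖ = 1) (θ : ℝ) (h0 : 0 ≤ θ)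
    (h1 : θ ≤ Real.pi) (h : inner ℝ x y = Real.cos θ) : angle x y = θ := by
  rw [angle, hx, hy, h]; simp [Real.arccos_cos h0 h1]

lemma slerp (p e : E) (hp : ‖p‖ = 1) (he : ‖e‖ = 1) (s : ℝ) (hs0 : 0 ≤ s)
    (hs : s ≤ angle p e) (hlt : angle p e < Real.pi) :
    ∃ q : E, ‖q‖ = 1 ∧ angle p q = s ∧ angle q e = angle p e - s := by
  set θ := angle p e with hθ
  rcases (angle_nonneg p e).eq_or_lt with h0 | h0
  · have : s = 0 := by linarith
    refine ⟨p, hp, ?_, ?_⟩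
    · rw [this, angle_self (norm_ne_zero_iff.1 (by rw [hp]; norm_num))]
    · rw [this, sub_zero]
  · have hsin : 0 < Real.sin θ := Real.sin_pos_of_pos_of_lt_pi h0 hlt
    have hpe : inner ℝ p e = Real.cos θ := cos_angle_unit p e hp he
    have hep : inner ℝ e p = Real.cos θ := by rw [real_inner_comm, hpe]
    have hpp : inner ℝ p p = (1 : ℝ) := by rw [real_inner_self_eq_norm_sq, hp]; norm_num
    have hee : inner ℝ e e = (1 : ℝ) := by rw [real_inner_self_eq_norm_sq, he]; norm_num
    set q : E := (Real.sin θ)⁻¹ • (Real.sin (θ - s) • p + Real.sin s • e) with hq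
    have hpq : inner ℝ p q = Real.cos s := by
      rw [hq, real_inner_smul_right, inner_add_right, real_inner_smul_right,
        real_inner_smul_right, hpp, hpe, Real.sin_sub]
      field_simp; ring
    have heq : inner ℝ e q = Real.cos (θ - s) := by
      rw [hq, real_inner_smul_right, inner_add_right, real_inner_smul_right,
        real_inner_smul_right, hee, hep, Real.sin_sub, Real.cos_sub]
      field_simp
      have := Real.sin_sq_add_cos_sq θ
      linear_combination (Real.sin s) * (-this)
    have hqq : ‖q‖ = 1 := by
      have : inner ℝ q q = (1 : ℝ) := by
        nth_rewrite 1 [hq]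
        rw [real_inner_smul_left, inner_add_left, real_inner_smul_left, real_inner_smul_left,
          hpq, heq]
        have : Real.sin (θ - s) * Real.cos s + Real.sin s * Real.cos (θ - s) = Real.sin θ := by
          have := Real.sin_add (θ - s) s
          rw [sub_add_cancel] at this
          rw [this]; ring
        rw [this, inv_mul_cancel₀ hsin.ne']
      rw [real_inner_self_eq_norm_sq] at this
      nlinarith [norm_nonneg q]
    refine ⟨q, hqq, angle_eq_of_inner _ _ hp hqq s hs0 (by linarith) hpq, ?_⟩
    rw [angle_comm]
    exact angle_eq_of_inner _ _ he hqq _ (by linarith) (by linarith) heq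

lemma step (p e : E) (hp : ‖p‖ = 1) (he : ‖e‖ = 1) (r d : ℝ) (hd0 : 0 ≤ d) (hd : d ≤ 2 * r)
    (hr : r < Real.pi) (hpe : angle p e ≤ r) :
    ∃ q : E, ‖q‖ = 1 ∧ ∀ x, angle p x ≤ r ∨ angle e x ≤ d → angle q x ≤ r + d / 2 := by
  by_cases h : d / 2 ≤ angle p e
  · obtain ⟨q, hq, h1, h2⟩ := slerp p e hp he (d / 2) (by linarith) h (by linarith)
    refine ⟨q, hq, ?_⟩
    rintro x (hx | hx)
    · have := angle_le_angle_add_angle q p x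
      rw [angle_comm q p] at this
      linarith
    · have := angle_le_angle_add_angle q e x
      linarith
  · refine ⟨e, he, ?_⟩
    rintro x (hx | hx)
    · have := angle_le_angle_add_angle e p x
      rw [angle_comm e p] at this
      linarith
    · linarith

lemma chain {ι : Type*} (W : Set E) (hconn : IsPreconnected W) (hWu : ∀ x ∈ W, ‖x‖ = 1)
    (hne : W.Nonempty)
    (t : Finset ι) (A : ι → Set E) (d : ι → ℝ) (δ : ℝ) (hδ : 0 < δ)
    (hA : ∀ i ∈ t, IsOpen (A i)) (hAW : ∀ i ∈ t, (W ∩ A i).Nonempty) (hcov : W ⊆ ⋃ i ∈ t, A i)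
    (hd0 : ∀ i ∈ t, 0 ≤ d i) (hdδ : ∀ i ∈ t, d i ≤ 2 * δ)
    (hd : ∀ i ∈ t, ∀ x ∈ W ∩ A i, ∀ y ∈ W ∩ A i, angle x y ≤ d i)
    (hsum : δ + (∑ i ∈ t, d i) / 2 < Real.pi) :
    ∃ p : E, ‖p‖ = 1 ∧ ∀ x ∈ W, angle p x ≤ δ + (∑ i ∈ t, d i) / 2 := by
  classical
  let Q : Finset ι → Prop := fun S => S.Nonempty ∧ ∃ p : E, ‖p‖ = 1 ∧
    ∀ i ∈ S, ∀ x ∈ W ∩ A i, angle p x ≤ δ + (∑ i ∈ S, d i) / 2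
  have hstart : ∃ i ∈ t, Q {i} := by
    obtain ⟨w, hw⟩ := hne
    obtain ⟨i, hi⟩ := mem_iUnion.1 (hcov hw)
    obtain ⟨hit, hi⟩ := mem_iUnion.1 hi
    refine ⟨i, hit, by simp, w, hWu w hw, ?_⟩
    intro j hj x hx
    rw [Finset.mem_singleton] at hj; subst hj
    rw [Finset.sum_singleton]
    have := hd j hit w ⟨hw, hi⟩ x hx
    have := hdδ j hit
    linarith
  obtain ⟨i₀, hi₀, hQ₀⟩ := hstart
  obtain ⟨S, hS, hmax⟩ := (t.powerset.filter Q).exists_max_image Finset.card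
    ⟨{i₀}, by simp [hi₀, hQ₀]⟩
  rw [Finset.mem_filter, Finset.mem_powerset] at hS
  obtain ⟨hSt, hSne, p, hp, hpS⟩ := hS
  have hSeq : S = t := by
    by_contra hSne'
    have hss : S ⊂ t := hSt.ssubset_of_ne hSne'
    obtain ⟨k, hkt, hkS⟩ := Finset.exists_of_ssubset hss
    obtain ⟨j, hjS⟩ := hSne
    have hop : ∀ T : Finset ι, T ⊆ t → IsOpen (⋃ i ∈ T, A i) := fun T hT =>
      isOpen_biUnion fun i hi => hA i (hT hi)
    obtain ⟨e, heW, he1, he2⟩ := hconn _ _ (hop S hSt) (hop (t \ S) Finset.sdiff_subset)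
      (by
        intro w hw
        obtain ⟨i, hi⟩ := mem_iUnion.1 (hcov hw)
        obtain ⟨hit, hi⟩ := mem_iUnion.1 hi
        by_cases h : i ∈ S
        · exact Or.inl (mem_biUnion (Finset.mem_coe.2 h) hi)
        · exact Or.inr (mem_biUnion (Finset.mem_coe.2 (Finset.mem_sdiff.2 ⟨hit, h⟩)) hi))
      (by
        obtain ⟨w, hw, hwA⟩ := hAW j (hSt hjS)
        exact ⟨w, hw, mem_biUnion (Finset.mem_coe.2 hjS) hwA⟩)
      (by
        obtain ⟨w, hw, hwA⟩ := hAW k hkt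
        exact ⟨w, hw, mem_biUnion (Finset.mem_coe.2 (Finset.mem_sdiff.2 ⟨hkt, hkS⟩)) hwA⟩)
    obtain ⟨a, ha⟩ := mem_iUnion.1 he1
    obtain ⟨haS, ha⟩ := mem_iUnion.1 ha
    obtain ⟨b, hb⟩ := mem_iUnion.1 he2
    obtain ⟨hbS, hb⟩ := mem_iUnion.1 hb
    obtain ⟨hbt, hbS⟩ := Finset.mem_sdiff.1 hbS
    have hsumS : 0 ≤ ∑ i ∈ S, d i := Finset.sum_nonneg fun i hi => hd0 i (hSt hi)
    have hsumSt : ∑ i ∈ S, d i ≤ ∑ i ∈ t, d i :=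
      Finset.sum_le_sum_of_subset_of_nonneg hSt fun i hi _ => hd0 i hi
    obtain ⟨q, hq, hq2⟩ := step p e hp (hWu e heW) (δ + (∑ i ∈ S, d i) / 2) (d b) (hd0 b hbt)
      (by have := hdδ b hbt; linarith) (by linarith) (hpS a haS e ⟨heW, ha⟩)
    have hQ : Q (insert b S) := by
      refine ⟨by simp, q, hq, ?_⟩
      intro i hi x hx
      rw [Finset.sum_insert hbS]
      have : angle q x ≤ δ + (∑ i ∈ S, d i) / 2 + d b / 2 := by
        apply hq2
        rcases Finset.mem_insert.1 hi with rfl | hi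
        · exact Or.inr (hd i hbt e ⟨heW, hb⟩ x hx)
        · exact Or.inl (hpS i hi x hx)
      linarith
    have := hmax (insert b S) (by
      rw [Finset.mem_filter, Finset.mem_powerset]
      exact ⟨Finset.insert_subset hbt hSt, hQ⟩)
    rw [Finset.card_insert_of_notMem hbS] at this
    omega
  subst hSeq
  refine ⟨p, hp, fun x hx => ?_⟩
  obtain ⟨i, hi⟩ := mem_iUnion.1 (hcov hx)
  obtain ⟨hit, hi⟩ := mem_iUnion.1 hi
  exact hpS i hit x ⟨hx, hi⟩

lemma angle_le_chord (κ : ℝ) (hκ : 1 < κ) : ∃ ρ > 0, ∀ x y : E, ‖x‖ = 1 → ‖y‖ = 1 →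
    ‖x - y‖ ≤ ρ → angle x y ≤ κ * ‖x - y‖ := by
  have hκ' : 0 < 6 * (1 - 1 / κ) := by
    have : 1 / κ < 1 := by rw [div_lt_one (by linarith)]; exact hκ
    linarith
  refine ⟨Real.sqrt (6 * (1 - 1 / κ)), Real.sqrt_pos.2 hκ', ?_⟩
  intro x y hx hy hxy
  set c := ‖x - y‖ with hc
  have hc0 : 0 ≤ c := norm_nonneg _
  have hc2 : c ^ 2 ≤ 6 * (1 - 1 / κ) := by
    calc c ^ 2 ≤ (Real.sqrt (6 * (1 - 1 / κ))) ^ 2 := by gcongr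
      _ = _ := Real.sq_sqrt hκ'.le
  set a := angle x y / 2 with ha
  have ha0 : 0 ≤ a := by have := angle_nonneg x y; positivity
  have haπ : a ≤ Real.pi / 2 := by have := angle_le_pi x y; linarith
  have hsin0 : 0 ≤ Real.sin a := Real.sin_nonneg_of_nonneg_of_le_pi ha0 (by linarith [Real.pi_pos])
  have hcs : c = 2 * Real.sin a := by
    have h1 : c ^ 2 = (2 * Real.sin a) ^ 2 := by
      rw [hc, norm_sub_sq_real, hx, hy, cos_angle_unit x y hx hy]
      have : angle x y = 2 * a := by rw [ha]; ring
      rw [this, Real.cos_two_mul]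
      nlinarith [Real.sin_sq_add_cos_sq a]
    exact (sq_eq_sq₀ hc0 (by positivity)).1 h1
  have h2a : angle x y = 2 * a := by rw [ha]; ring
  rw [h2a]
  rcases ha0.eq_or_lt with h0 | h0
  · rw [← h0]; simp; positivity
  · have hs1 := Real.sin_gt_sub_cube h0
    have hs2 := Real.mul_le_sin ha0 haπ
    have hac : a ≤ c := by
      have : (1 / 2 : ℝ) ≤ 2 / Real.pi := by
        rw [div_le_div_iff₀ (by norm_num) Real.pi_pos]; linarith [Real.pi_le_four]
      have : 1 / 2 * a ≤ 2 / Real.pi * a := by gcongr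
      linarith
    have ha2 : a ^ 2 ≤ 6 * (1 - 1 / κ) := by
      have : a ^ 2 ≤ c ^ 2 := by gcongr
      linarith
    have h3 : a / κ ≤ a - a ^ 3 / 6 := by
      have : a * a ^ 2 ≤ a * (6 * (1 - 1 / κ)) := by gcongr
      have h4 : a / κ = a * (1 / κ) := by ring
      rw [h4]; nlinarith
    have h5 : a / κ ≤ Real.sin a := by linarith
    rw [div_le_iff₀ (by linarith)] at h5
    rw [hcs]; nlinarith

lemma hemisphere [MeasurableSpace E] [BorelSpace E] (W : Set E) (hW : IsCompact W)
    (hconn : IsPreconnected W) (hne : W.Nonempty) (hWu : ∀ x ∈ W, ‖x‖ = 1)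
    (hμ : μH[1] W < ENNReal.ofReal Real.pi) : ∃ u : E, W ⊆ {z | 0 < inner ℝ u z} := by
  classical
  obtain ⟨L, hL0, hμL, hLπ⟩ := ENNReal.lt_iff_exists_real_btwn.1 hμ
  have hLπ : L < Real.pi := (ENNReal.ofReal_lt_ofReal_iff Real.pi_pos).1 hLπ
  have hLpos : 0 < L := by
    by_contra h
    rw [ENNReal.ofReal_of_nonpos (not_lt.1 h)] at hμL
    exact not_lt_bot hμL
  obtain ⟨κ, hκ1, hκ2⟩ := exists_between ((one_lt_div hLpos).2 hLπ)
  have hκL : κ * L < Real.pi := (lt_div_iff₀ hLpos).1 hκ2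
  let δ : ℝ := (Real.pi - κ * L) / 4
  have hδ : 0 < δ := by simp only [δ]; linarith
  obtain ⟨ρ₀, hρ₀, hang⟩ := angle_le_chord (E := E) κ hκ1
  obtain ⟨ρ, hρ, hρ1, hρ2⟩ : ∃ ρ > 0, 3 * ρ ≤ ρ₀ ∧ κ * (3 * ρ) ≤ 2 * δ := by
    refine ⟨min (ρ₀ / 3) (2 * δ / (3 * κ)), by positivity, ?_, ?_⟩
    · have := min_le_left (ρ₀ / 3) (2 * δ / (3 * κ)); linarith
    · have := min_le_right (ρ₀ / 3) (2 * δ / (3 * κ))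
      rw [le_div_iff₀ (by positivity)] at this
      linarith
  rw [Measure.hausdorffMeasure_apply] at hμL
  have h1 := lt_of_le_of_lt (le_iSup₂ (f := fun (r : ENNReal) (_ : 0 < r) =>
    ⨅ (t : ℕ → Set E) (_ : W ⊆ ⋃ n, t n) (_ : ∀ n, ediam (t n) ≤ r),
          ∑' n, ⨆ _ : (t n).Nonempty, ediam (t n) ^ (1 : ℝ)) (ENNReal.ofReal ρ)
      (ENNReal.ofReal_pos.2 hρ)) hμL
  simp only [iInf_lt_iff] at h1
  obtain ⟨T, hTW, hTρ, hTsum⟩ := h1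
  simp only [ENNReal.rpow_one] at hTsum
  set T₀ := ∑' n, ⨆ _ : (T n).Nonempty, ediam (T n) with hT0
  have hη : 0 < min ((ENNReal.ofReal L - T₀) / 2) (ENNReal.ofReal ρ) := by
    refine lt_min (ENNReal.div_pos (tsub_pos_of_lt hTsum).ne' (by simp)) (by simpa using hρ)
  obtain ⟨ε, hε, hεsum⟩ := ENNReal.exists_pos_sum_of_countable hη.ne' ℕ
  have hερ : ∀ n, (ε n : ℝ) ≤ ρ := by
    intro n
    have h1 : (ε n : ENNReal) ≤ ENNReal.ofReal ρ :=
      (ENNReal.le_tsum n).trans (hεsum.le.trans (min_le_right _ _))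
    have := ENNReal.toReal_mono ENNReal.ofReal_ne_top h1
    rwa [ENNReal.toReal_ofReal hρ.le] at this
  let A : ℕ → Set E := fun n => thickening (ε n) (T n)
  have hAo : ∀ n, IsOpen (A n) := fun n => isOpen_thickening
  have hWA : W ⊆ ⋃ n, A n := hTW.trans
    (iUnion_mono fun n => self_subset_thickening (by exact_mod_cast hε n) _)
  obtain ⟨t₀, ht₀⟩ := hW.elim_finite_subcover A hAo hWA
  let t := t₀.filter fun n => (W ∩ A n).Nonempty
  have ht : W ⊆ ⋃ n ∈ t, A n := by
    intro w hw
    obtain ⟨i, hi⟩ := mem_iUnion.1 (ht₀ hw)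
    obtain ⟨hit, hi⟩ := mem_iUnion.1 hi
    exact mem_biUnion (Finset.mem_coe.2 (Finset.mem_filter.2 ⟨hit, w, hw, hi⟩)) hi
  have htne : ∀ n ∈ t, (T n).Nonempty := by
    intro n hn
    obtain ⟨w, -, hw⟩ := (Finset.mem_filter.1 hn).2
    obtain ⟨z, hz, -⟩ := mem_thickening_iff.1 hw
    exact ⟨z, hz⟩
  have hfin : ∀ n, ediam (T n) ≠ ⊤ := fun n => ((hTρ n).trans_lt ENNReal.ofReal_lt_top).ne
  let d' : ℕ → ℝ := fun n => (ediam (T n)).toReal + 2 * ε n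
  have hd'0 : ∀ n, 0 ≤ d' n := fun n => by simp only [d']; positivity
  have hd'3 : ∀ n, d' n ≤ 3 * ρ := by
    intro n
    have := ENNReal.toReal_mono ENNReal.ofReal_ne_top (hTρ n)
    rw [ENNReal.toReal_ofReal hρ.le] at this
    have := hερ n
    simp only [d']; linarith
  have hdist : ∀ n, ∀ x ∈ A n, ∀ y ∈ A n, ‖x - y‖ ≤ d' n := by
    intro n x hx y hy
    obtain ⟨a, ha, hxa⟩ := mem_thickening_iff.1 hx
    obtain ⟨b, hb, hyb⟩ := mem_thickening_iff.1 hy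
    have hab : dist a b ≤ (ediam (T n)).toReal := by
      rw [dist_edist]
      exact ENNReal.toReal_mono (hfin n) (edist_le_ediam_of_mem ha hb)
    have h1 := dist_triangle4 x a b y
    rw [dist_comm b y] at h1
    rw [← dist_eq_norm]
    simp only [d']; linarith
  have hsum : ∑ n ∈ t, d' n ≤ L := by
    have h1 : ∑ n ∈ t, (ediam (T n) + 2 * (ε n : ENNReal)) ≤ ENNReal.ofReal L := by
      rw [Finset.sum_add_distrib, ← Finset.mul_sum]
      calc ∑ n ∈ t, ediam (T n) + 2 * ∑ n ∈ t, (ε n : ENNReal)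
          ≤ T₀ + 2 * ((ENNReal.ofReal L - T₀) / 2) := by
            gcongr
            · calc ∑ n ∈ t, ediam (T n) = ∑ n ∈ t, ⨆ _ : (T n).Nonempty, ediam (T n) := by
                    refine Finset.sum_congr rfl fun n hn => ?_
                    simp [htne n hn]
                _ ≤ T₀ := ENNReal.sum_le_tsum t
            · exact (ENNReal.sum_le_tsum t).trans (hεsum.le.trans (min_le_left _ _))
        _ = ENNReal.ofReal L := by
            rw [ENNReal.mul_div_cancel (by simp) (by simp)]
            exact add_tsub_cancel_of_le hTsum.le
    have h2 := ENNReal.toReal_mono ENNReal.ofReal_ne_top h1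
    rw [ENNReal.toReal_ofReal hLpos.le, ENNReal.toReal_sum (fun n _ =>
      ENNReal.add_ne_top.2 ⟨hfin n, ENNReal.mul_ne_top (by simp) (by simp)⟩)] at h2
    refine le_trans (le_of_eq (Finset.sum_congr rfl fun n _ => ?_)) h2
    rw [ENNReal.toReal_add (hfin n) (ENNReal.mul_ne_top (by simp) (by simp))]
    simp [d']
  have hκ0 : 0 < κ := by linarith
  have hsum2 : δ + (∑ n ∈ t, κ * d' n) / 2 < Real.pi / 2 := by
    rw [← Finset.mul_sum]
    have : κ * ∑ n ∈ t, d' n ≤ κ * L := by gcongr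
    simp only [δ]; linarith
  obtain ⟨p, hp, hpW⟩ := chain W hconn hWu hne t A (fun n => κ * d' n) δ hδ (fun n _ => hAo n)
    (fun n hn => (Finset.mem_filter.1 hn).2) ht (fun n _ => mul_nonneg hκ0.le (hd'0 n))
    (fun n _ => le_trans (by have := hd'3 n; gcongr) hρ2)
    (fun n _ x hx y hy => by
      have h1 := hdist n x hx.2 y hy.2
      have h2 := hang x y (hWu x hx.1) (hWu y hy.1) (h1.trans ((hd'3 n).trans hρ1))
      exact h2.trans (by gcongr))
    (by linarith [Real.pi_pos])
  refine ⟨p, fun x hx => ?_⟩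
  have h1 := hpW x hx
  show 0 < inner ℝ p x
  rw [cos_angle_unit p x hp (hWu x hx)]
  exact Real.cos_pos_of_mem_Ioo ⟨by linarith [angle_nonneg p x, Real.pi_pos], by linarith⟩

end WaistAux

/-- **Gromov-type waist bound in codimension one for the sphere**: for `n ≥ 1` and a
continuous map `f : S^n → ℝ^{n-1}`, some fiber `f⁻¹(y)` has a connected component `W`
whose one-dimensional Hausdorff measure is at least `π`. -/
theorem codim_one_waist_sphere
    (n : ℕ) (hn : 1 ≤ n)
    (f : EuclideanSpace ℝ (Fin (n + 1)) → EuclideanSpace ℝ (Fin (n - 1)))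
    (hf : ContinuousOn f (Metric.sphere 0 1)) :
    ∃ (y : EuclideanSpace ℝ (Fin (n - 1))) (x : EuclideanSpace ℝ (Fin (n + 1))),
      ‖x‖ = 1 ∧ f x = y ∧
      ENNReal.ofReal Real.pi ≤
        μH[1] (connectedComponentIn
          {z : EuclideanSpace ℝ (Fin (n + 1)) | ‖z‖ = 1 ∧ f z = y} x) := by
  by_contra! hcon
  refine WaistAux.topological (by simp; omega) f hf ?_
  intro x hx
  set F : Set (EuclideanSpace ℝ (Fin (n + 1))) := {z | ‖z‖ = 1 ∧ f z = f x} with hF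
  have hxF : x ∈ F := ⟨hx, rfl⟩
  have hFc : IsCompact F := by
    have h1 : F = Metric.sphere 0 1 ∩ f ⁻¹' {f x} := by
      ext z; simp [hF]
    rw [h1]
    exact (isCompact_sphere 0 1).of_isClosed_subset
      (hf.preimage_isClosed_of_isClosed Metric.isClosed_sphere isClosed_singleton)
      Set.inter_subset_left
  have hWc : IsCompact (connectedComponentIn F x) := by
    have : CompactSpace F := isCompact_iff_compactSpace.1 hFc
    rw [connectedComponentIn_eq_image hxF]
    exact isClosed_connectedComponent.isCompact.image continuous_subtype_val
  exact WaistAux.hemisphere (connectedComponentIn F x) hWc isPreconnected_connectedComponentIn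
    ⟨x, mem_connectedComponentIn hxF⟩
    (fun z hz => (connectedComponentIn_subset F x hz).1) (hcon (f x) x hx rfl)
end
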